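/- Consider the scalar Gaussian two-level security wiretap channel Y = √a·X + N1, Z1 = √b1·X + N2, Z2 = √b2·X + N3 with b1 ≥ b2 ≥ 0, a ≥ 0, where N1, N2, N3 are independent standard Gaussian noises, and the input is subject to the average power constraint (1/n)∑_{i=1}^n (X[i])^2 ≤ P. The secrecy capacity region of the channel is exactly the set of all nonnegative pairs (R1,R2) satisfying R1 ≤ Cs(P,a,b1) and R1 + R2 ≤ Cs(P,a,b2), where Cs(P,a,b) := [ (1/2)log(1+aP) − (1/2)log(1+bP) ]^+ and [x]^+ := max(0,x). -/

import Mathlib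

open MeasureTheory ProbabilityTheory
open scoped BigOperators ENNReal
noncomputable section

/-- Kullback–Leibler divergence (in bits) of `μ` from `ν`. -/
def klDivBits {Ω : Type*} [MeasurableSpace Ω] (μ ν : Measure Ω) : ℝ :=
  ∫ ω, Real.logb 2 ((μ.rnDeriv ν ω).toReal) ∂μ

/-- Mutual information (in bits) of a joint law on `α × β`: the KL divergence between the
joint law and the product of its marginals. -/
def miBits {α β : Type*} [MeasurableSpace α] [MeasurableSpace β]
    (μ : Measure (α × β)) : ℝ :=
  klDivBits μ ((μ.map Prod.fst).prod (μ.map Prod.snd))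

/-- Law of the output of a memoryless Gaussian channel with gain `a` (output
`√a · x + N` with `N` standard Gaussian) on input sequence `xs`. -/
def gaussOut {n : ℕ} (a : ℝ) (xs : Fin n → ℝ) : Measure (Fin n → ℝ) :=
  Measure.pi fun i => gaussianReal (Real.sqrt a * xs i) 1

/-- Joint law of the (uniform, independent) message pair and the length-`n` output of the
Gaussian channel with gain `a`, for the stochastic encoder `enc`. -/
def jointLaw {n K₁ K₂ : ℕ} (a : ℝ) (enc : Fin K₁ × Fin K₂ → Measure (Fin n → ℝ)) :
    Measure ((Fin K₁ × Fin K₂) × (Fin n → ℝ)) :=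
  ((K₁ : ℝ≥0∞) * (K₂ : ℝ≥0∞))⁻¹ •
    Measure.sum fun m : Fin K₁ × Fin K₂ =>
      (Measure.dirac m).prod ((enc m).bind (gaussOut a))

/-- Achievability of the rate pair `(R₁,R₂)` for the scalar Gaussian two-level security
wiretap channel `Y = √a X + N₁`, `Z₁ = √b₁ X + N₂`, `Z₂ = √b₂ X + N₃` under the average
power constraint `P`: there are codes of blocklength `n` with rates arbitrarily close to
`(R₁,R₂)`, inputs satisfying the power constraint, vanishing decoding error probability,
vanishing normalized leakage `(1/n) I(M₁,M₂;Z₂ⁿ)` and vanishing normalized leakage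
`(1/n) I(M₁;Z₁ⁿ)`. -/
def GaussAchievable (a b₁ b₂ P R₁ R₂ : ℝ) : Prop :=
  ∀ ε > 0, ∃ n : ℕ, 0 < n ∧ ∃ K₁ K₂ : ℕ, 0 < K₁ ∧ 0 < K₂ ∧
    (n : ℝ) * (R₁ - ε) ≤ Real.logb 2 K₁ ∧ (n : ℝ) * (R₂ - ε) ≤ Real.logb 2 K₂ ∧
    ∃ enc : Fin K₁ × Fin K₂ → Measure (Fin n → ℝ),
      (∀ m, IsProbabilityMeasure (enc m)) ∧
      (∀ m, enc m {xs | ∑ i, (xs i) ^ 2 ≤ (n : ℝ) * P} = 1) ∧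
      ∃ dec : (Fin n → ℝ) → Fin K₁ × Fin K₂, Measurable dec ∧
        (jointLaw a enc {p | dec p.2 ≠ p.1}).toReal ≤ ε ∧
        miBits (jointLaw b₂ enc) ≤ (n : ℝ) * ε ∧
        miBits ((jointLaw b₁ enc).map fun p => (p.1.1, p.2)) ≤ (n : ℝ) * ε

/-- The secrecy capacity `Cs(P,a,b)` of the scalar Gaussian wiretap channel. -/
def Cs (P a b : ℝ) : ℝ :=
  max 0 ((1 / 2) * Real.logb 2 (1 + a * P) - (1 / 2) * Real.logb 2 (1 + b * P))

namespace WT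

open InformationTheory
open scoped NNReal

lemma lintegral_pi_prod {ι : Type*} [Fintype ι] {Ω : ι → Type*} [∀ i, MeasurableSpace (Ω i)]
    (μ : ∀ i, Measure (Ω i)) [∀ i, IsProbabilityMeasure (μ i)]
    (f : ∀ i, Ω i → ℝ≥0∞) (hf : ∀ i, Measurable (f i)) :
    ∫⁻ y, ∏ i, f i (y i) ∂(Measure.pi μ) = ∏ i, ∫⁻ t, f i t ∂(μ i) := by
  have h := lintegral_prod_eq_prod_lintegral_of_indepFun (μ := Measure.pi μ) Finset.univ
    (fun i (y : ∀ i, Ω i) => f i (y i))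
    (iIndepFun_pi (X := f) fun i => (hf i).aemeasurable)
    (fun i => (hf i).comp (measurable_pi_apply i))
  rw [h]
  refine Finset.prod_congr rfl fun i _ => ?_
  rw [← (measurePreserving_eval μ i).lintegral_comp (hf i)]

lemma pi_withDensity' {ι : Type*} [Fintype ι] {Ω : ι → Type*} [∀ i, MeasurableSpace (Ω i)]
    (μ ν : ∀ i, Measure (Ω i)) [∀ i, IsProbabilityMeasure (μ i)]
    [∀ i, IsProbabilityMeasure (ν i)]
    (f : ∀ i, Ω i → ℝ≥0∞) (hf : ∀ i, Measurable (f i))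
    (h : ∀ i, ν i = (μ i).withDensity (f i)) :
    Measure.pi ν = (Measure.pi μ).withDensity (fun y => ∏ i, f i (y i)) := by
  apply Measure.pi_eq
  intro s hs
  rw [withDensity_apply _ (MeasurableSet.univ_pi hs), ← lintegral_indicator (MeasurableSet.univ_pi hs)]
  have : ∀ y : ∀ i, Ω i, (Set.univ.pi s).indicator (fun y => ∏ i, f i (y i)) y
      = ∏ i, (s i).indicator (f i) (y i) := by
    intro y
    by_cases hy : y ∈ Set.univ.pi s
    · rw [Set.indicator_of_mem hy]
      refine Finset.prod_congr rfl fun i _ => ?_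
      rw [Set.indicator_of_mem (hy i (Set.mem_univ i))]
    · rw [Set.indicator_of_notMem hy]
      simp only [Set.mem_pi, Set.mem_univ, true_imp_iff, not_forall] at hy
      obtain ⟨i, hi⟩ := hy
      exact (Finset.prod_eq_zero (Finset.mem_univ i) (Set.indicator_of_notMem hi _)).symm
  simp_rw [this]
  rw [lintegral_pi_prod μ _ (fun i => (hf i).indicator (hs i))]
  refine Finset.prod_congr rfl fun i _ => ?_
  rw [lintegral_indicator (hs i), h i, withDensity_apply _ (hs i)]

/-- memoryless Gaussian kernel with gain `c` and noise variance `v` -/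
def gk (n : ℕ) (c : ℝ) (v : ℝ≥0) : Kernel (Fin n → ℝ) (Fin n → ℝ) :=
  (Kernel.id ×ₖ Kernel.const (Fin n → ℝ) (Measure.pi fun _ : Fin n => gaussianReal 0 v)).map
    (fun p i => c * p.1 i + p.2 i)

instance (n : ℕ) (c : ℝ) (v : ℝ≥0) : IsMarkovKernel (gk n c v) := by
  unfold gk
  exact Kernel.IsMarkovKernel.map _ (by fun_prop)

lemma gk_map (n : ℕ) (c : ℝ) (v : ℝ≥0) (y : Fin n → ℝ) :
    gk n c v y = (Measure.pi fun _ : Fin n => gaussianReal 0 v).map (fun z i => c * y i + z i) := by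
  rw [gk, Kernel.map_apply _ (by fun_prop), Kernel.prod_apply, Kernel.id_apply, Kernel.const_apply,
    Measure.dirac_prod, Measure.map_map (by fun_prop) (by fun_prop)]
  rfl

lemma gk_apply (n : ℕ) (c : ℝ) (v : ℝ≥0) (y : Fin n → ℝ) :
    gk n c v y = Measure.pi fun i => gaussianReal (c * y i) v := by
  rw [gk_map]
  have := Measure.pi_map_pi (μ := fun _ : Fin n => gaussianReal 0 v)
    (f := fun i (t : ℝ) => c * y i + t) (fun i => by fun_prop)
  rw [this]
  congr 1
  ext1 i
  rw [gaussianReal_map_const_add]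
  simp

lemma gaussOut_eq {n : ℕ} (a : ℝ) : (gaussOut a : (Fin n → ℝ) → _) = gk n (Real.sqrt a) 1 := by
  ext1 x
  rw [gk_apply]; rfl

lemma gauss_comp1 (c m : ℝ) (u v w : ℝ≥0) (hw : (w : ℝ) = c ^ 2 * u + v) (s : Set ℝ)
    (hs : MeasurableSet s) :
    ∫⁻ y, gaussianReal (c * y) v s ∂(gaussianReal m u) = gaussianReal (c * m) w s := by
  have h1 : gaussianReal (c * m) w = (gaussianReal (c*m) (NNReal.mk (c ^ 2) (sq_nonneg _) * u)) ∗ (gaussianReal 0 v) := by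
    rw [gaussianReal_conv_gaussianReal]
    congr 1
    · simp
    · apply NNReal.eq; push_cast; exact hw
  rw [h1, Measure.conv, Measure.map_apply (by fun_prop) hs, Measure.prod_apply (by measurability),
    ← gaussianReal_map_const_mul, lintegral_map (by
      exact measurable_measure_prodMk_left (by measurability)) (by fun_prop)]
  refine lintegral_congr fun y => ?_
  have := gaussianReal_map_const_add (μ := 0) (v := v) (c * y)
  rw [zero_add] at this
  rw [← this, Measure.map_apply (by fun_prop) hs]
  rfl

lemma gk_comp_pi (n : ℕ) (c : ℝ) (u v w : ℝ≥0) (hw : (w : ℝ) = c ^ 2 * u + v) (m : Fin n → ℝ) :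
    gk n c v ∘ₘ (Measure.pi fun i => gaussianReal (m i) u)
      = Measure.pi fun i => gaussianReal (c * m i) w := by
  symm
  apply Measure.pi_eq
  intro s hs
  rw [Measure.bind_apply (MeasurableSet.univ_pi hs) (Kernel.aemeasurable _)]
  simp_rw [gk_apply, Measure.pi_pi]
  rw [lintegral_pi_prod (fun i => gaussianReal (m i) u) (fun i y => gaussianReal (c * y) v (s i))]
  · exact Finset.prod_congr rfl fun i _ => gauss_comp1 c (m i) u v w hw (s i) (hs i)
  · intro i
    exact (Measure.measurable_coe (hs i)).comp
      (measurable_gaussianReal.comp (by fun_prop : Measurable fun y : ℝ => (c * y, v)))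

end WT

namespace WT

open InformationTheory
open scoped NNReal

lemma klDiv_map_equiv {α β : Type*} [MeasurableSpace α] [MeasurableSpace β] (e : α ≃ᵐ β)
    (μ ν : Measure α) [IsFiniteMeasure μ] [IsFiniteMeasure ν] :
    klDiv (μ.map e) (ν.map e) = klDiv μ ν := by
  apply le_antisymm (klDiv_map_le μ ν e.measurable)
  have := klDiv_map_le (μ.map e) (ν.map e) e.symm.measurable
  simpa [Measure.map_map e.symm.measurable e.measurable] using this

lemma klDiv_compens {X Y : Type*} [MeasurableSpace X] [StandardBorelSpace X] [Nonempty X]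
    [MeasurableSpace Y] (ν : Measure X) [IsProbabilityMeasure ν] (W : Kernel X Y)
    [IsMarkovKernel W] (g : Measure Y) [IsProbabilityMeasure g] :
    klDiv (ν ⊗ₘ W) (ν.prod g)
      = klDiv (W ∘ₘ ν) g + klDiv (ν ⊗ₘ W) (ν.prod (W ∘ₘ ν)) := by
  have key : ∀ h : Measure Y, IsProbabilityMeasure h → klDiv (ν ⊗ₘ W) (ν.prod h)
      = klDiv ((W ∘ₘ ν) ⊗ₘ W†ν) (h ⊗ₘ Kernel.const Y ν) := by
    intro h hh
    rw [compProd_posterior_eq_map_swap, Measure.compProd_const, ← Measure.prod_swap (μ := ν) (ν := h)]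
    exact (klDiv_map_equiv MeasurableEquiv.prodComm (ν ⊗ₘ W) (ν.prod h)).symm
  rw [key g inferInstance, key (W ∘ₘ ν) inferInstance, klDiv_compProd_eq_add]

lemma klDiv_mi_le {X Y Z : Type*} [MeasurableSpace X] 
    [MeasurableSpace Y] [MeasurableSpace Z] (ν : Measure X) [IsProbabilityMeasure ν]
    (W : Kernel X Y) [IsMarkovKernel W] (κ : Kernel Y Z) [IsMarkovKernel κ] :
    klDiv (ν ⊗ₘ (κ ∘ₖ W)) (ν.prod ((κ ∘ₖ W) ∘ₘ ν)) ≤ klDiv (ν ⊗ₘ W) (ν.prod (W ∘ₘ ν)) := by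
  have h := klDiv_comp_right_le (ν ⊗ₘ W) (ν.prod (W ∘ₘ ν)) (Kernel.id ∥ₖ κ)
  rw [Measure.parallelComp_comp_compProd] at h
  have h2 : (Kernel.id ∥ₖ κ) ∘ₘ (ν.prod (W ∘ₘ ν)) = ν.prod ((κ ∘ₖ W) ∘ₘ ν) := by
    rw [← Measure.compProd_const, Measure.parallelComp_comp_compProd, Kernel.comp_const,
      Measure.compProd_const, Measure.comp_assoc]
  rwa [h2] at h

lemma compProd_eq_withDensity_of_ac {M Y : Type*} [Fintype M] [MeasurableSpace M]
    [MeasurableSingletonClass M] [MeasurableSpace Y] (U : Measure M) [IsProbabilityMeasure U]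
    (κ : Kernel M Y) [IsMarkovKernel κ] (g : Measure Y) [IsProbabilityMeasure g]
    (hac : ∀ m, κ m ≪ g) :
    Measurable (fun p : M × Y => (κ p.1).rnDeriv g p.2) ∧ 
    U ⊗ₘ κ = (U.prod g).withDensity (fun p => (κ p.1).rnDeriv g p.2) := by
  have hm : Measurable (fun p : M × Y => (κ p.1).rnDeriv g p.2) :=
    measurable_from_prod_countable_right fun m => Measure.measurable_rnDeriv (κ m) g
  refine ⟨hm, ?_⟩
  ext s hs
  rw [Measure.compProd_apply hs, withDensity_apply _ hs, ← lintegral_indicator hs,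
    lintegral_prod _ (hm.indicator hs).aemeasurable]
  refine lintegral_congr fun m => ?_
  have hs' : MeasurableSet (Prod.mk m ⁻¹' s) := measurable_prodMk_left hs
  rw [← Measure.setLIntegral_rnDeriv (hac m), ← lintegral_indicator hs']
  rfl

lemma klDiv_avg {M Y : Type*} [Fintype M] [MeasurableSpace M]
    [MeasurableSingletonClass M] [MeasurableSpace Y] (U : Measure M) [IsProbabilityMeasure U]
    (κ : Kernel M Y) [IsMarkovKernel κ] (g : Measure Y) [IsProbabilityMeasure g]
    (hac : ∀ m, κ m ≪ g) :
    klDiv (U ⊗ₘ κ) (U.prod g) = ∫⁻ m, klDiv (κ m) g ∂U := by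
  obtain ⟨hm, he⟩ := compProd_eq_withDensity_of_ac U κ g hac
  have hac' : U ⊗ₘ κ ≪ U.prod g := by rw [he]; exact withDensity_absolutelyContinuous _ _
  rw [klDiv_eq_lintegral_klFun_of_ac hac']
  have h1 : (U ⊗ₘ κ).rnDeriv (U.prod g) =ᵐ[U.prod g] (fun p => (κ p.1).rnDeriv g p.2) := by
    rw [he]; exact Measure.rnDeriv_withDensity _ hm
  rw [lintegral_congr_ae (g := fun p : M × Y => ENNReal.ofReal (klFun ((κ p.1).rnDeriv g p.2).toReal))
    (by filter_upwards [h1] with p hp; rw [hp]), lintegral_prod]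
  · refine lintegral_congr fun m => ?_
    rw [klDiv_eq_lintegral_klFun_of_ac (hac m)]
  · exact (ENNReal.measurable_ofReal.comp (measurable_klFun.comp hm.ennreal_toReal)).aemeasurable

lemma miBits_eq {M Y : Type*} [MeasurableSpace M] [MeasurableSpace Y] (U : Measure M)
    [IsProbabilityMeasure U] (κ : Kernel M Y) [IsMarkovKernel κ]
    (h : klDiv (U ⊗ₘ κ) (U.prod (κ ∘ₘ U)) ≠ ⊤) :
    miBits (U ⊗ₘ κ) = (klDiv (U ⊗ₘ κ) (U.prod (κ ∘ₘ U))).toReal / Real.log 2 := by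
  have h1 : (U ⊗ₘ κ).map Prod.fst = U := Measure.fst_compProd U κ
  have h2 : (U ⊗ₘ κ).map Prod.snd = κ ∘ₘ U := Measure.snd_compProd U κ
  rw [klDiv_ne_top_iff] at h
  rw [miBits, klDivBits, h1, h2, toReal_klDiv_of_measure_eq h.1 (by simp), ← integral_div]
  rfl

/-- Lower bound on the divergence from a test event (Fano). -/
lemma fano {Ω : Type*} [MeasurableSpace Ω] (μ ν : Measure Ω) [IsProbabilityMeasure μ]
    [IsProbabilityMeasure ν] (h : klDiv μ ν ≠ ⊤) (E : Set Ω) (hE : MeasurableSet E) (K ε : ℝ)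
    (hK : 1 ≤ K) (hε : 0 < ε) (hε1 : ε < 1) (hν : ν.real E ≤ 1 / K) (hμ : 1 - ε ≤ μ.real E) :
    (1 - ε) * Real.log K + Real.log (1 - ε) + ε * Real.log ε ≤ (klDiv μ ν).toReal := by
  have h' := klDiv_ne_top_iff.1 h
  obtain ⟨hac, hintg⟩ := h'
  have hK0 : 0 < K := by linarith
  rw [toReal_klDiv_eq_integral_klFun hac]
  set f := fun ω => (μ.rnDeriv ν ω).toReal with hf
  set T1 := Real.log (K * (1 - ε)) with hT1
  set T0 := Real.log ε with hT0
  have hfi : Integrable f ν := Measure.integrable_toReal_rnDeriv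
  have young : ∀ x t : ℝ, 0 ≤ x → x * t - Real.exp t + 1 ≤ klFun x := by
    intro x t hx
    rw [klFun_apply]
    rcases hx.eq_or_lt with rfl | hx
    · simp; positivity
    · have := Real.add_one_le_exp (t - Real.log x)
      rw [Real.exp_sub, Real.exp_log hx, le_div_iff₀ hx] at this
      nlinarith
  have hpt : ∀ ω, E.indicator (fun ω => f ω * T1 - Real.exp T1 + 1) ω
      + Eᶜ.indicator (fun ω => f ω * T0 - Real.exp T0 + 1) ω ≤ klFun (f ω) := by
    intro ω
    by_cases hω : ω ∈ E
    · simp only [hω, Set.indicator_of_mem, Set.mem_compl_iff, not_true, not_false_iff,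
        Set.indicator_of_notMem, add_zero]
      exact young _ _ ENNReal.toReal_nonneg
    · simp only [hω, Set.indicator_of_mem, Set.mem_compl_iff, not_false_iff,
        Set.indicator_of_notMem, zero_add]
      exact young _ _ ENNReal.toReal_nonneg
  have i1 : Integrable (fun ω => f ω * T1 - Real.exp T1 + 1) ν := by fun_prop
  have i0 : Integrable (fun ω => f ω * T0 - Real.exp T0 + 1) ν := by fun_prop
  have hle := integral_mono ((i1.indicator hE).add (i0.indicator hE.compl))
    ((integrable_klFun_rnDeriv_iff hac).2 hintg) hpt
  have e : ∀ (A : Set Ω), MeasurableSet A → ∀ T : ℝ, ∫ ω, A.indicator (fun ω => f ω * T - Real.exp T + 1) ω ∂ν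
      = μ.real A * T - ν.real A * Real.exp T + ν.real A := by
    intro A hA T
    have hfA : Integrable f (ν.restrict A) := hfi.restrict
    have hs1 : Integrable (fun ω => f ω * T - Real.exp T) (ν.restrict A) :=
      (hfA.mul_const T).sub (integrable_const _)
    rw [integral_indicator hA, integral_add hs1 (by fun_prop),
      integral_sub (hfA.mul_const T) (by fun_prop), integral_mul_const,
      Measure.setIntegral_toReal_rnDeriv hac]
    simp
  simp only [Pi.add_apply] at hle
  rw [integral_add (i1.indicator hE) (i0.indicator hE.compl), e _ hE, e _ hE.compl] at hle
  refine le_trans ?_ hle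
  rw [probReal_compl_eq_one_sub hE, probReal_compl_eq_one_sub hE, hT1, hT0,
    Real.exp_log (by nlinarith), Real.exp_log hε, Real.log_mul (by positivity) (by linarith)]
  have hp1 : μ.real E ≤ 1 := measureReal_le_one
  have hlK : 0 ≤ Real.log K := Real.log_nonneg hK
  have hl1 : Real.log (1 - ε) ≤ 0 := Real.log_nonpos (by linarith) (by linarith)
  have hl0 : Real.log ε ≤ 0 := Real.log_nonpos (by linarith) (by linarith)
  have hq : ν.real E * (K * (1 - ε)) ≤ 1 - ε := by
    have : ν.real E * K ≤ 1 := by rwa [le_div_iff₀ hK0] at hν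
    nlinarith
  have hq0 : 0 ≤ ν.real E := measureReal_nonneg
  nlinarith [mul_le_mul_of_nonneg_right hμ hlK, mul_nonneg (sub_nonneg.2 hp1) (neg_nonneg.2 hl1),
    mul_nonneg (sub_nonneg.2 hμ) (neg_nonneg.2 hl0), mul_nonneg hq0 hε.le]

end WT

namespace WT

open InformationTheory
open scoped NNReal

/-- uniform law on a finite type -/
def unif (M : Type*) [Fintype M] [MeasurableSpace M] : Measure M :=
  (Fintype.card M : ℝ≥0∞)⁻¹ • Measure.count

lemma lintegral_unif {M : Type*} [Fintype M] [MeasurableSpace M] [MeasurableSingletonClass M]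
    (f : M → ℝ≥0∞) : ∫⁻ m, f m ∂(unif M) = (Fintype.card M : ℝ≥0∞)⁻¹ * ∑ m, f m := by
  rw [unif, lintegral_smul_measure, lintegral_count, tsum_fintype]; rfl

instance {M : Type*} [Fintype M] [Nonempty M] [MeasurableSpace M] [MeasurableSingletonClass M] :
    IsProbabilityMeasure (unif M) := by
  constructor
  have := lintegral_unif (M := M) (fun _ => 1)
  simp only [lintegral_one, Finset.sum_const, Finset.card_univ, nsmul_eq_mul, mul_one] at this
  rw [this, ENNReal.inv_mul_cancel (by simp) (by simp)]

/-- kernel from a finite type -/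
def kof {M X : Type*} [Fintype M] [MeasurableSpace M] [MeasurableSingletonClass M]
    [MeasurableSpace X] (E : M → Measure X) : Kernel M X := Kernel.ofFunOfCountable E

lemma kof_apply {M X : Type*} [Fintype M] [MeasurableSpace M] [MeasurableSingletonClass M]
    [MeasurableSpace X] (E : M → Measure X) (m : M) : kof E m = E m := rfl

instance {M X : Type*} [Fintype M] [MeasurableSpace M] [MeasurableSingletonClass M]
    [MeasurableSpace X] (E : M → Measure X) [∀ m, IsProbabilityMeasure (E m)] :
    IsMarkovKernel (kof E) := ⟨fun m => by rw [kof_apply]; infer_instance⟩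

/-- conditional encoder for the first message -/
def enc1 {n K₁ K₂ : ℕ} (enc : Fin K₁ × Fin K₂ → Measure (Fin n → ℝ)) (m₁ : Fin K₁) :
    Measure (Fin n → ℝ) := (K₂ : ℝ≥0∞)⁻¹ • ∑ m₂, enc (m₁, m₂)

instance {n K₁ K₂ : ℕ} [NeZero K₂] (enc : Fin K₁ × Fin K₂ → Measure (Fin n → ℝ))
    [∀ m, IsProbabilityMeasure (enc m)] (m₁ : Fin K₁) : IsProbabilityMeasure (enc1 enc m₁) := by
  constructor
  simp only [enc1, Measure.smul_apply, Measure.finsetSum_apply, measure_univ, Finset.sum_const,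
    Finset.card_univ, Fintype.card_fin, nsmul_eq_mul, mul_one, smul_eq_mul]
  rw [ENNReal.inv_mul_cancel (by simp [NeZero.ne]) (by simp)]

lemma jointLaw_apply {n K₁ K₂ : ℕ} (a : ℝ) (enc : Fin K₁ × Fin K₂ → Measure (Fin n → ℝ))
    [∀ m, IsProbabilityMeasure (enc m)] (s : Set ((Fin K₁ × Fin K₂) × (Fin n → ℝ)))
    (hs : MeasurableSet s) :
    jointLaw a enc s = ((K₁ : ℝ≥0∞) * (K₂ : ℝ≥0∞))⁻¹ *
      ∑ m, (gk n (Real.sqrt a) 1 ∘ₘ enc m) (Prod.mk m ⁻¹' s) := by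
  rw [jointLaw, Measure.smul_apply, Measure.sum_apply _ hs, tsum_fintype, smul_eq_mul, gaussOut_eq]
  congr 1
  refine Finset.sum_congr rfl fun m _ => ?_
  rw [Measure.dirac_prod, Measure.map_apply (by fun_prop) hs]

lemma jointLaw_eq {n K₁ K₂ : ℕ} [NeZero K₁] [NeZero K₂] (a : ℝ)
    (enc : Fin K₁ × Fin K₂ → Measure (Fin n → ℝ)) [∀ m, IsProbabilityMeasure (enc m)] :
    jointLaw a enc = unif (Fin K₁ × Fin K₂) ⊗ₘ (gk n (Real.sqrt a) 1 ∘ₖ kof enc) := by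
  ext s hs
  rw [jointLaw_apply a enc s hs, Measure.compProd_apply hs, lintegral_unif]
  simp [Kernel.comp_apply, kof_apply]

lemma jointLaw_map_eq {n K₁ K₂ : ℕ} [NeZero K₁] [NeZero K₂] (a : ℝ)
    (enc : Fin K₁ × Fin K₂ → Measure (Fin n → ℝ)) [∀ m, IsProbabilityMeasure (enc m)] :
    (jointLaw a enc).map (fun p => (p.1.1, p.2))
      = unif (Fin K₁) ⊗ₘ (gk n (Real.sqrt a) 1 ∘ₖ kof (enc1 enc)) := by
  ext s hs
  have hm : Measurable fun p : (Fin K₁ × Fin K₂) × (Fin n → ℝ) => (p.1.1, p.2) := by fun_prop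
  rw [Measure.map_apply hm hs, jointLaw_apply a enc _ (hm hs), Measure.compProd_apply hs,
    lintegral_unif, Fintype.sum_prod_type, ENNReal.mul_inv (by simp) (by simp), mul_assoc,
    Finset.mul_sum]
  simp only [Fintype.card_fin]
  congr 1
  refine Finset.sum_congr rfl fun m _ => ?_
  have hs' : MeasurableSet (Prod.mk m ⁻¹' s) := measurable_prodMk_left hs
  rw [Kernel.comp_apply, kof_apply, enc1, Measure.bind_apply hs' (Kernel.aemeasurable _),
    lintegral_smul_measure, lintegral_finsetSum_measure, smul_eq_mul]
  congr 1
  refine Finset.sum_congr rfl fun m₂ _ => ?_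
  rw [← Measure.bind_apply hs' (Kernel.aemeasurable _)]
  rfl

end WT

namespace WT

open InformationTheory
open scoped NNReal

/-- one-letter information density -/
def ld1 (s P x y : ℝ) : ℝ :=
  1 / 2 * Real.log (1 + s * P) - (y - Real.sqrt s * x) ^ 2 / 2 + y ^ 2 / (2 * (1 + s * P))

/-- variance of the reference output -/
def ov (s P : ℝ) : ℝ≥0 := (1 + s * P).toNNReal

lemma ov_coe {s P : ℝ} (hs : 0 ≤ s) (hP : 0 ≤ P) : (ov s P : ℝ) = 1 + s * P :=
  Real.coe_toNNReal _ (by positivity)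

lemma ov_ne {s P : ℝ} (hs : 0 ≤ s) (hP : 0 ≤ P) : ov s P ≠ 0 := by
  intro h
  have := ov_coe hs hP
  rw [h] at this
  have h2 : 0 ≤ s * P := by positivity
  simp at this; linarith

/-- one-letter likelihood ratio -/
def w1 (s P x y : ℝ) : ℝ≥0∞ := ENNReal.ofReal (Real.exp (ld1 s P x y))

lemma measurable_ld1 (s P : ℝ) : Measurable (fun p : ℝ × ℝ => ld1 s P p.1 p.2) := by
  unfold ld1; fun_prop

lemma measurable_w1 (s P : ℝ) : Measurable (fun p : ℝ × ℝ => w1 s P p.1 p.2) :=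
  ENNReal.measurable_ofReal.comp (Real.measurable_exp.comp (measurable_ld1 s P))

lemma measurable_w1_r (s P x : ℝ) : Measurable (w1 s P x) := by
  unfold w1 ld1; fun_prop

lemma measurable_w1_l (s P y : ℝ) : Measurable (fun x => w1 s P x y) := by
  unfold w1 ld1; fun_prop

lemma exp_half_log {v : ℝ} (hv : 0 < v) : Real.exp (1 / 2 * Real.log v) = Real.sqrt v := by
  rw [Real.sqrt_eq_rpow, Real.rpow_def_of_pos hv, mul_comm]

lemma gauss_dens1 {s P : ℝ} (hs : 0 ≤ s) (hP : 0 ≤ P) (x : ℝ) :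
    gaussianReal (Real.sqrt s * x) 1 = (gaussianReal 0 (ov s P)).withDensity (w1 s P x) := by
  have hv : 0 < 1 + s * P := by positivity
  have hw : Measurable (w1 s P x) := measurable_w1_r s P _
  rw [gaussianReal_of_var_ne_zero _ one_ne_zero, gaussianReal_of_var_ne_zero _ (ov_ne hs hP),
    ← withDensity_mul _ (measurable_gaussianPDF _ _) hw]
  congr 1
  ext1 y
  rw [Pi.mul_apply, gaussianPDF, gaussianPDF, w1, ← ENNReal.ofReal_mul (gaussianPDFReal_nonneg _ _ _)]
  congr 1
  rw [gaussianPDFReal, gaussianPDFReal, ov_coe hs hP, mul_assoc (Real.sqrt _)⁻¹ (Real.exp (-(y - 0) ^ 2 / (2 * (1 + s * P)))), ← Real.exp_add]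
  have h1 : -(y - 0) ^ 2 / (2 * (1 + s * P)) + ld1 s P x y
      = 1 / 2 * Real.log (1 + s * P) + (-(y - Real.sqrt s * x) ^ 2 / (2 * ((1 : ℝ≥0) : ℝ))) := by
    rw [ld1]; push_cast; field_simp; ring
  rw [h1, Real.exp_add, exp_half_log hv, ← mul_assoc]
  congr 1
  rw [Real.sqrt_mul (by positivity) (1 + s * P)]
  have : Real.sqrt (1 + s * P) ≠ 0 := by positivity
  push_cast
  field_simp

lemma lint_w1 {s P : ℝ} (hs : 0 ≤ s) (hP : 0 < P) (y : ℝ) :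
    ∫⁻ x, w1 s P x y ∂(gaussianReal 0 P.toNNReal) = 1 := by
  have hv : 0 < 1 + s * P := by positivity
  have hPc : ((P.toNNReal : ℝ≥0) : ℝ) = P := Real.coe_toNNReal _ hP.le
  have hP0 : P.toNNReal ≠ 0 := by simpa using hP
  have hq : 0 < P / (1 + s * P) := by positivity
  have hqc : (((P / (1 + s * P)).toNNReal : ℝ≥0) : ℝ) = P / (1 + s * P) := Real.coe_toNNReal _ hq.le
  have hw : Measurable (fun x => w1 s P x y) := measurable_w1_l s P _
  rw [gaussianReal_of_var_ne_zero _ hP0,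
    lintegral_withDensity_eq_lintegral_mul _ (measurable_gaussianPDF _ _) hw]
  rw [← lintegral_gaussianPDF_eq_one (Real.sqrt s * P * y / (1 + s * P))
    (v := (P / (1 + s * P)).toNNReal) (by simpa using hq)]
  refine lintegral_congr fun x => ?_
  rw [Pi.mul_apply, gaussianPDF, gaussianPDF, w1, ← ENNReal.ofReal_mul (gaussianPDFReal_nonneg _ _ _)]
  congr 1
  rw [gaussianPDFReal, gaussianPDFReal, hPc, hqc, mul_assoc, ← Real.exp_add]
  have hss : Real.sqrt s ^ 2 = s := Real.sq_sqrt hs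
  have h1 : -(x - 0) ^ 2 / (2 * P) + ld1 s P x y
      = 1 / 2 * Real.log (1 + s * P) + (-(x - Real.sqrt s * P * y / (1 + s * P)) ^ 2 / (2 * (P / (1 + s * P)))) := by
    have : ∀ r : ℝ, r ^ 2 = s → -(x - 0) ^ 2 / (2 * P) + (1 / 2 * Real.log (1 + s * P) - (y - r * x) ^ 2 / 2 + y ^ 2 / (2 * (1 + s * P)))
      = 1 / 2 * Real.log (1 + s * P) + (-(x - r * P * y / (1 + s * P)) ^ 2 / (2 * (P / (1 + s * P)))) := by
      intro r hr
      subst hr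
      field_simp
      ring
    exact this _ hss
  rw [h1, Real.exp_add, exp_half_log hv, ← mul_assoc]
  congr 1
  rw [Real.sqrt_mul (by positivity) P, Real.sqrt_mul (by positivity) (P / _), Real.sqrt_div hP.le]
  have : Real.sqrt (1 + s * P) ≠ 0 := by positivity
  have : Real.sqrt P ≠ 0 := by positivity
  field_simp

/-- information density -/
def ld {n : ℕ} (s P : ℝ) (x y : Fin n → ℝ) : ℝ := ∑ i, ld1 s P (x i) (y i)

/-- likelihood ratio -/
def lr {n : ℕ} (s P : ℝ) (x y : Fin n → ℝ) : ℝ≥0∞ := ENNReal.ofReal (Real.exp (ld s P x y))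

/-- reference output law -/
def Qm (n : ℕ) (s P : ℝ) : Measure (Fin n → ℝ) := Measure.pi fun _ => gaussianReal 0 (ov s P)

instance (n : ℕ) (s P : ℝ) : IsProbabilityMeasure (Qm n s P) := by unfold Qm; infer_instance

lemma lr_eq {n : ℕ} (s P : ℝ) (x y : Fin n → ℝ) : lr s P x y = ∏ i, w1 s P (x i) (y i) := by
  rw [lr, ld, Real.exp_sum, ENNReal.ofReal_prod_of_nonneg (fun _ _ => (Real.exp_pos _).le)]
  rfl

lemma measurable_ld {n : ℕ} (s P : ℝ) :
    Measurable (fun p : (Fin n → ℝ) × (Fin n → ℝ) => ld s P p.1 p.2) := by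
  unfold ld ld1; fun_prop

lemma measurable_lr {n : ℕ} (s P : ℝ) :
    Measurable (fun p : (Fin n → ℝ) × (Fin n → ℝ) => lr s P p.1 p.2) :=
  ENNReal.measurable_ofReal.comp (Real.measurable_exp.comp (measurable_ld s P))

lemma gk_dens {n : ℕ} {s P : ℝ} (hs : 0 ≤ s) (hP : 0 ≤ P) (x : Fin n → ℝ) :
    gk n (Real.sqrt s) 1 x = (Qm n s P).withDensity (lr s P x) := by
  have h := pi_withDensity' (fun _ : Fin n => gaussianReal 0 (ov s P))
    (fun i => gaussianReal (Real.sqrt s * x i) 1) (fun i => w1 s P (x i))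
    (fun i => measurable_w1_r s P _) (fun i => gauss_dens1 hs hP (x i))
  rw [gk_apply, h, Qm]
  congr 1
  ext1 y
  rw [lr_eq]

lemma lint_lr {n : ℕ} {s P : ℝ} (hs : 0 ≤ s) (hP : 0 < P) (y : Fin n → ℝ) :
    ∫⁻ x, lr s P x y ∂(Measure.pi fun _ : Fin n => gaussianReal 0 P.toNNReal) = 1 := by
  simp_rw [lr_eq]
  rw [lintegral_pi_prod (fun _ : Fin n => gaussianReal 0 P.toNNReal) (fun i x => w1 s P x (y i))
    (fun i => measurable_w1_l s P _)]
  simp [lint_w1 hs hP]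

lemma compProd_dens {n : ℕ} {s P : ℝ} (hs : 0 ≤ s) (hP : 0 ≤ P) (E : Measure (Fin n → ℝ))
    [IsProbabilityMeasure E] :
    E ⊗ₘ gk n (Real.sqrt s) 1 = (E.prod (Qm n s P)).withDensity (fun p => lr s P p.1 p.2) := by
  have hm := measurable_lr (n := n) s P
  ext t ht
  rw [Measure.compProd_apply ht, withDensity_apply _ ht, ← lintegral_indicator ht,
    lintegral_prod _ (hm.indicator ht).aemeasurable]
  refine lintegral_congr fun m => ?_
  have hs' : MeasurableSet (Prod.mk m ⁻¹' t) := measurable_prodMk_left ht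
  rw [gk_dens hs hP, withDensity_apply _ hs', ← lintegral_indicator hs']
  rfl

/-- standard noise law -/
def nz (n : ℕ) : Measure (Fin n → ℝ) := Measure.pi fun _ => gaussianReal 0 1

instance (n : ℕ) : IsProbabilityMeasure (nz n) := by unfold nz; infer_instance

lemma compProd_map {n : ℕ} (c : ℝ) (E : Measure (Fin n → ℝ)) [IsProbabilityMeasure E] :
    E ⊗ₘ gk n c 1 = (E.prod (nz n)).map (fun p => (p.1, fun i => c * p.1 i + p.2 i)) := by
  ext t ht
  rw [Measure.compProd_apply ht, Measure.map_apply (by fun_prop) ht,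
    Measure.prod_apply (by exact (by fun_prop : Measurable fun p : (Fin n → ℝ) × (Fin n → ℝ) => (p.1, fun i => c * p.1 i + p.2 i)) ht)]
  refine lintegral_congr fun x => ?_
  rw [gk_map, Measure.map_apply (by fun_prop) (measurable_prodMk_left ht)]
  rfl

/-- divergence of a Gaussian channel from the product reference law -/
lemma klDiv_compProd_Q {n : ℕ} {s P : ℝ} (hs : 0 ≤ s) (hP : 0 ≤ P) (E : Measure (Fin n → ℝ))
    [IsProbabilityMeasure E]
    (hi : Integrable (fun p => ld s P p.1 p.2) (E ⊗ₘ gk n (Real.sqrt s) 1)) :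
    klDiv (E ⊗ₘ gk n (Real.sqrt s) 1) (E.prod (Qm n s P))
      = ENNReal.ofReal (∫ p, ld s P p.1 p.2 ∂(E ⊗ₘ gk n (Real.sqrt s) 1)) := by
  have hd := compProd_dens hs hP E
  have hac : E ⊗ₘ gk n (Real.sqrt s) 1 ≪ E.prod (Qm n s P) := by
    rw [hd]; exact withDensity_absolutelyContinuous _ _
  have h1 : (E ⊗ₘ gk n (Real.sqrt s) 1).rnDeriv (E.prod (Qm n s P))
      =ᵐ[E.prod (Qm n s P)] (fun p => lr s P p.1 p.2) := by
    rw [hd]; exact Measure.rnDeriv_withDensity _ (measurable_lr s P)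
  have h2 : llr (E ⊗ₘ gk n (Real.sqrt s) 1) (E.prod (Qm n s P))
      =ᵐ[E ⊗ₘ gk n (Real.sqrt s) 1] fun p => ld s P p.1 p.2 := by
    filter_upwards [hac.ae_le h1] with p hp
    rw [llr, hp, lr, ENNReal.toReal_ofReal (Real.exp_pos _).le, Real.log_exp]
  rw [klDiv_of_ac_of_integrable hac ((integrable_congr h2).2 hi), integral_congr_ae h2]
  simp

end WT

namespace WT

open InformationTheory
open scoped NNReal

lemma measurableSet_pball (n : ℕ) (P : ℝ) :
    MeasurableSet {xs : Fin n → ℝ | ∑ i, (xs i) ^ 2 ≤ (n : ℝ) * P} :=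
  measurableSet_le (by fun_prop) measurable_const

lemma ae_pball {n : ℕ} {P : ℝ} (E : Measure (Fin n → ℝ)) [IsProbabilityMeasure E]
    (hE : E {xs | ∑ i, (xs i) ^ 2 ≤ (n : ℝ) * P} = 1) : ∀ᵐ x ∂E, ∑ i, (x i) ^ 2 ≤ (n : ℝ) * P :=
  (prob_compl_eq_zero_iff (measurableSet_pball n P)).2 hE

lemma integrable_sq_coord {n : ℕ} {P : ℝ} (E : Measure (Fin n → ℝ)) [IsProbabilityMeasure E]
    (hE : E {xs | ∑ i, (xs i) ^ 2 ≤ (n : ℝ) * P} = 1) (i : Fin n) :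
    Integrable (fun x => x i) E ∧ Integrable (fun x => (x i) ^ 2) E := by
  have hae := ae_pball E hE
  have hae' : ∀ᵐ x ∂E, (x i) ^ 2 ≤ (n : ℝ) * P := by
    filter_upwards [hae] with x hx
    exact (Finset.single_le_sum (f := fun i => (x i) ^ 2) (fun i _ => sq_nonneg _)
      (Finset.mem_univ i)).trans hx
  constructor
  · refine Integrable.of_bound (measurable_pi_apply i).aestronglyMeasurable ((n : ℝ) * P + 1) ?_
    filter_upwards [hae'] with x hx
    rw [Real.norm_eq_abs, abs_le]
    constructor <;> nlinarith [sq_nonneg (x i + 1), sq_nonneg (x i - 1)]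
  · refine Integrable.of_bound ((measurable_pi_apply i).pow_const 2).aestronglyMeasurable ((n : ℝ) * P) ?_
    filter_upwards [hae'] with x hx
    rw [Real.norm_eq_abs, abs_of_nonneg (sq_nonneg _)]
    exact hx

lemma nz_coord {n : ℕ} (i : Fin n) :
    Integrable (fun x : Fin n → ℝ => x i) (nz n) ∧ Integrable (fun x => (x i) ^ 2) (nz n) ∧
    ∫ x, x i ∂(nz n) = 0 ∧ ∫ x, (x i) ^ 2 ∂(nz n) = 1 := by
  have hp := measurePreserving_eval (fun _ : Fin n => gaussianReal 0 1) i
  have h1 : Integrable (fun t : ℝ => t) (gaussianReal 0 1) :=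
    (memLp_id_gaussianReal' (μ := 0) (v := 1) 1 (by simp)).integrable le_rfl
  have h2 : Integrable (fun t : ℝ => t ^ 2) (gaussianReal 0 1) :=
    (memLp_id_gaussianReal' (μ := 0) (v := 1) 2 (by simp)).integrable_sq
  refine ⟨hp.integrable_comp_of_integrable h1, hp.integrable_comp_of_integrable h2, ?_, ?_⟩
  · have := integral_map (μ := nz n) (φ := Function.eval i) hp.measurable.aemeasurable
      (f := fun t : ℝ => t) (by fun_prop)
    rw [nz, hp.map_eq] at this
    simpa [integral_id_gaussianReal, nz] using this.symm
  · have := integral_map (μ := nz n) (φ := Function.eval i) hp.measurable.aemeasurable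
      (f := fun t : ℝ => t ^ 2) (by fun_prop)
    rw [nz, hp.map_eq] at this
    have hv := variance_fun_id_gaussianReal (μ := 0) (v := 1)
    rw [variance_of_integral_eq_zero (by fun_prop) (by simp)] at hv
    rw [hv] at this
    simpa [nz] using this.symm

lemma ld_integral {n : ℕ} {s P : ℝ} (hs : 0 ≤ s) (hP : 0 ≤ P) (E : Measure (Fin n → ℝ))
    [IsProbabilityMeasure E] (hE : E {xs | ∑ i, (xs i) ^ 2 ≤ (n : ℝ) * P} = 1) :
    Integrable (fun p => ld s P p.1 p.2) (E ⊗ₘ gk n (Real.sqrt s) 1) ∧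
    ∫ p, ld s P p.1 p.2 ∂(E ⊗ₘ gk n (Real.sqrt s) 1)
      = n * (1 / 2 * Real.log (1 + s * P)) - n / 2 
        + (s * (∫ x, ∑ i, (x i) ^ 2 ∂E) + n) / (2 * (1 + s * P)) := by
  have hv : 0 < 1 + s * P := by positivity
  have hφ : Measurable (fun p : (Fin n → ℝ) × (Fin n → ℝ) => (p.1, fun i => Real.sqrt s * p.1 i + p.2 i)) := by
    fun_prop
  rw [compProd_map, integrable_map_measure (measurable_ld s P).aestronglyMeasurable hφ.aemeasurable,
    integral_map hφ.aemeasurable (measurable_ld s P).aestronglyMeasurable]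
  have key : ∀ i : Fin n, 
    Integrable (fun p : (Fin n → ℝ) × (Fin n → ℝ) => ld1 s P (p.1 i) (Real.sqrt s * p.1 i + p.2 i)) (E.prod (nz n)) ∧
    ∫ p : (Fin n → ℝ) × (Fin n → ℝ), ld1 s P (p.1 i) (Real.sqrt s * p.1 i + p.2 i) ∂(E.prod (nz n))
      = 1 / 2 * Real.log (1 + s * P) - 1 / 2 + (s * (∫ x, (x i) ^ 2 ∂E) + 1) / (2 * (1 + s * P)) := by
    intro i
    obtain ⟨e1, e2⟩ := integrable_sq_coord E hE i
    obtain ⟨n1, n2, n3, n4⟩ := nz_coord i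
    have he : (fun p : (Fin n → ℝ) × (Fin n → ℝ) => ld1 s P (p.1 i) (Real.sqrt s * p.1 i + p.2 i))
      = fun p => 1 / 2 * Real.log (1 + s * P) + (1 / (2 * (1 + s * P)) - 1 / 2) * (1 * (p.2 i) ^ 2)
        + s / (2 * (1 + s * P)) * ((p.1 i) ^ 2 * 1) + Real.sqrt s / (1 + s * P) * (p.1 i * p.2 i) := by
      ext p
      have : ∀ r : ℝ, r ^ 2 = s → (1 / 2 * Real.log (1 + s * P) - (r * p.1 i + p.2 i - r * p.1 i) ^ 2 / 2 + (r * p.1 i + p.2 i) ^ 2 / (2 * (1 + s * P))) = 1 / 2 * Real.log (1 + s * P) + (1 / (2 * (1 + s * P)) - 1 / 2) * (1 * (p.2 i) ^ 2)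
        + s / (2 * (1 + s * P)) * ((p.1 i) ^ 2 * 1) + r / (1 + s * P) * (p.1 i * p.2 i) := by
        intro r hr
        subst hr
        field_simp
        ring
      exact this _ (Real.sq_sqrt hs)
    have j1 : Integrable (fun p : (Fin n → ℝ) × (Fin n → ℝ) => (1:ℝ) * (p.2 i) ^ 2) (E.prod (nz n)) :=
      Integrable.mul_prod (f := fun _ => (1:ℝ)) (integrable_const 1) n2
    have j2 : Integrable (fun p : (Fin n → ℝ) × (Fin n → ℝ) => (p.1 i) ^ 2 * (1:ℝ)) (E.prod (nz n)) :=
      Integrable.mul_prod (g := fun _ => (1:ℝ)) e2 (integrable_const 1)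
    have j3 : Integrable (fun p : (Fin n → ℝ) × (Fin n → ℝ) => p.1 i * p.2 i) (E.prod (nz n)) :=
      Integrable.mul_prod (f := fun x : Fin n → ℝ => x i) (g := fun x : Fin n → ℝ => x i) e1 n1
    have k1 : ∫ p : (Fin n → ℝ) × (Fin n → ℝ), (1:ℝ) * (p.2 i) ^ 2 ∂(E.prod (nz n)) = 1 := by
      rw [integral_prod_mul (fun _ => (1:ℝ)) (fun x : Fin n → ℝ => (x i) ^ 2), n4]; simp
    have k2 : ∫ p : (Fin n → ℝ) × (Fin n → ℝ), (p.1 i) ^ 2 * (1:ℝ) ∂(E.prod (nz n)) = ∫ x, (x i) ^ 2 ∂E := by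
      rw [integral_prod_mul (fun x : Fin n → ℝ => (x i) ^ 2) (fun _ => (1:ℝ))]; simp
    have k3 : ∫ p : (Fin n → ℝ) × (Fin n → ℝ), p.1 i * p.2 i ∂(E.prod (nz n)) = 0 := by
      rw [integral_prod_mul (fun x : Fin n → ℝ => x i) (fun x : Fin n → ℝ => x i), n3]; simp
    rw [he]
    have l1 := (integrable_const (μ := E.prod (nz n)) (1 / 2 * Real.log (1 + s * P))).add
      (j1.const_mul (1 / (2 * (1 + s * P)) - 1 / 2))
    have l2 := l1.add (j2.const_mul (s / (2 * (1 + s * P))))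
    have l3 := l2.add (j3.const_mul (Real.sqrt s / (1 + s * P)))
    refine ⟨l3, ?_⟩
    refine (integral_add l2 (j3.const_mul _)).trans ?_
    refine (congrArg (· + _) ((integral_add l1 (j2.const_mul _)).trans
      (congrArg (· + _) (integral_add (integrable_const _) (j1.const_mul _))))).trans ?_
    rw [integral_const_mul (_ - _), integral_const_mul (s / _), integral_const_mul (Real.sqrt s / _), k1, k2, k3, integral_const]
    simp only [probReal_univ, one_smul]
    field_simp
    ring
  refine ⟨integrable_finsetSum Finset.univ fun i _ => (key i).1, ?_⟩
  have : ∀ p : (Fin n → ℝ) × (Fin n → ℝ), ld s P p.1 (fun i => Real.sqrt s * p.1 i + p.2 i)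
    = ∑ i, ld1 s P (p.1 i) (Real.sqrt s * p.1 i + p.2 i) := fun p => rfl
  simp_rw [this]
  rw [integral_finsetSum _ fun i _ => (key i).1, Finset.sum_congr rfl fun i _ => (key i).2,
    integral_finsetSum _ fun i _ => (integrable_sq_coord E hE i).2]
  simp only [Finset.sum_add_distrib, Finset.sum_sub_distrib, Finset.sum_const, Finset.card_univ,
    Fintype.card_fin, nsmul_eq_mul, ← Finset.sum_div, Finset.mul_sum]
  ring

lemma klDiv_Q_le {n : ℕ} {a b P : ℝ} (hb : 0 ≤ b) (hab : b ≤ a) (hP : 0 ≤ P)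
    (E : Measure (Fin n → ℝ))
    [IsProbabilityMeasure E] (hE : E {xs | ∑ i, (xs i) ^ 2 ≤ (n : ℝ) * P} = 1) :
    klDiv (E ⊗ₘ gk n (Real.sqrt a) 1) (E.prod (Qm n a P)) ≠ ⊤ ∧ 
    klDiv (E ⊗ₘ gk n (Real.sqrt b) 1) (E.prod (Qm n b P)) ≠ ⊤ ∧ 
    klDiv (E ⊗ₘ gk n (Real.sqrt a) 1) (E.prod (Qm n a P)) ≤ 
      klDiv (E ⊗ₘ gk n (Real.sqrt b) 1) (E.prod (Qm n b P)) +
      ENNReal.ofReal (n / 2 * (Real.log (1 + a * P) - Real.log (1 + b * P))) := by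
  have ha : 0 ≤ a := hb.trans hab
  obtain ⟨ia, ea⟩ := ld_integral ha hP E hE
  obtain ⟨ib, eb⟩ := ld_integral hb hP E hE
  rw [klDiv_compProd_Q ha hP E ia, klDiv_compProd_Q hb hP E ib]
  refine ⟨ENNReal.ofReal_ne_top, ENNReal.ofReal_ne_top, ?_⟩
  refine le_trans ?_ ENNReal.ofReal_add_le
  apply ENNReal.ofReal_le_ofReal
  rw [ea, eb]
  set t := ∫ x, ∑ i, (x i) ^ 2 ∂E with ht
  have htP : t ≤ n * P := by
    have hae := ae_pball E hE
    have := integral_mono_ae (integrable_finsetSum _ fun i _ => (integrable_sq_coord E hE i).2)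
      (integrable_const ((n : ℝ) * P)) hae
    simpa using this
  have hva : 0 < 1 + a * P := by positivity
  have hvb : 0 < 1 + b * P := by positivity
  have : (a * t + n) / (2 * (1 + a * P)) ≤ (b * t + n) / (2 * (1 + b * P)) := by
    rw [div_le_div_iff₀ (by positivity) (by positivity)]
    nlinarith [mul_nonneg (sub_nonneg.2 hab) (sub_nonneg.2 htP)]
  linarith

lemma exists_degrade (n : ℕ) {a b P : ℝ} (hb : 0 ≤ b) (hab : b ≤ a) (hP : 0 ≤ P) :
    ∃ κ : Kernel (Fin n → ℝ) (Fin n → ℝ), IsMarkovKernel κ ∧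
      gk n (Real.sqrt b) 1 = κ ∘ₖ gk n (Real.sqrt a) 1 ∧ κ ∘ₘ Qm n a P = Qm n b P := by
  have ha : 0 ≤ a := hb.trans hab
  have hr : b / a ≤ 1 := div_le_one_of_le₀ hab ha
  have hr0 : 0 ≤ b / a := by positivity
  have hra : b / a * a = b := by
    rcases eq_or_ne a 0 with h | h
    · subst h; simp; linarith
    · field_simp
  have hvc : (((1 - b / a).toNNReal : ℝ≥0) : ℝ) = 1 - b / a := Real.coe_toNNReal _ (by linarith)
  refine ⟨gk n (Real.sqrt (b / a)) (1 - b / a).toNNReal, inferInstance, ?_, ?_⟩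
  · ext1 x
    rw [Kernel.comp_apply, gk_apply, gk_apply n (Real.sqrt a), gk_comp_pi n _ 1 _ 1]
    · congr 1; ext1 i
      rw [← mul_assoc, ← Real.sqrt_mul hr0, hra]
    · rw [Real.sq_sqrt hr0, hvc]; push_cast; ring
  · unfold Qm
    rw [gk_comp_pi n _ (ov a P) _ (ov b P)]
    · simp
    · rw [Real.sq_sqrt hr0, hvc, ov_coe ha hP, ov_coe hb hP]
      linear_combination -P * hra

/-- mutual information (nats) between a uniform message and channel output -/
def MI {n : ℕ} {M : Type*} [Fintype M] [MeasurableSpace M] [MeasurableSingletonClass M]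
    (s : ℝ) (E : M → Measure (Fin n → ℝ)) : ℝ≥0∞ :=
  klDiv (unif M ⊗ₘ (gk n (Real.sqrt s) 1 ∘ₖ kof E))
    ((unif M).prod ((gk n (Real.sqrt s) 1 ∘ₖ kof E) ∘ₘ unif M))

lemma MI_conv_gt {n : ℕ} {M : Type*} [Fintype M] [Nonempty M] [MeasurableSpace M]
    [StandardBorelSpace M] [MeasurableSingletonClass M] {a b P : ℝ} (hb : 0 ≤ b) (hab : b ≤ a) (hP : 0 ≤ P)
    (E : M → Measure (Fin n → ℝ)) [∀ m, IsProbabilityMeasure (E m)]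
    (hE : ∀ m, E m {xs | ∑ i, (xs i) ^ 2 ≤ (n : ℝ) * P} = 1) :
    MI a E ≠ ⊤ ∧ MI b E ≠ ⊤ ∧ MI b E ≤ MI a E ∧
    MI a E ≤ MI b E + ENNReal.ofReal (n / 2 * (Real.log (1 + a * P) - Real.log (1 + b * P))) := by
  obtain ⟨κ, hκ, hW, hQ⟩ := exists_degrade n hb hab hP
  set C := ENNReal.ofReal (n / 2 * (Real.log (1 + a * P) - Real.log (1 + b * P))) with hC
  set Wa := gk n (Real.sqrt a) 1 with hWa
  set Wb := gk n (Real.sqrt b) 1 with hWb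
  have hm : ∀ m, klDiv (Wa ∘ₘ E m) (Qm n a P) ≠ ⊤ ∧ klDiv (Wb ∘ₘ E m) (Qm n b P) ≠ ⊤ ∧
      klDiv (Wa ∘ₘ E m) (Qm n a P) ≤ klDiv (Wb ∘ₘ E m) (Qm n b P) + C := by
    intro m
    obtain ⟨h1, h2, h3⟩ := klDiv_Q_le hb hab hP (E m) (hE m)
    have h4 := klDiv_mi_le (E m) Wa κ
    rw [klDiv_compens] at h1 h2
    rw [klDiv_compens (E m) (gk n (Real.sqrt a) 1), klDiv_compens (E m) (gk n (Real.sqrt b) 1)] at h3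
    rw [← hW] at h4
    rw [← hWa] at h1 h3
    rw [← hWb] at h2 h3
    rw [← hC] at h3
    have h5 := ENNReal.add_ne_top.1 h1
    refine ⟨h5.1, (ENNReal.add_ne_top.1 h2).1, ?_⟩
    refine (ENNReal.add_le_add_iff_right h5.2).1 (h3.trans ?_)
    calc _ ≤ klDiv (Wb ∘ₘ E m) (Qm n b P) + klDiv (E m ⊗ₘ Wa) ((E m).prod (Wa ∘ₘ E m)) + C := by gcongr
      _ = _ := by ring
  have aca : ∀ m, (Wa ∘ₖ kof E) m ≪ Qm n a P := fun m => by
    rw [Kernel.comp_apply]; exact (klDiv_ne_top_iff.1 (hm m).1).1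
  have acb : ∀ m, (Wb ∘ₖ kof E) m ≪ Qm n b P := fun m => by
    rw [Kernel.comp_apply]; exact (klDiv_ne_top_iff.1 (hm m).2.1).1
  have Da := klDiv_avg (unif M) (Wa ∘ₖ kof E) (Qm n a P) aca
  have Db := klDiv_avg (unif M) (Wb ∘ₖ kof E) (Qm n b P) acb
  have Ca := klDiv_compens (unif M) (Wa ∘ₖ kof E) (Qm n a P)
  have Cb := klDiv_compens (unif M) (Wb ∘ₖ kof E) (Qm n b P)
  have hDa : klDiv (unif M ⊗ₘ (Wa ∘ₖ kof E)) ((unif M).prod (Qm n a P)) ≠ ⊤ := by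
    rw [Da, lintegral_unif]
    refine ENNReal.mul_ne_top (by simp) (ENNReal.sum_ne_top.2 fun m _ => ?_)
    rw [Kernel.comp_apply]; exact (hm m).1
  have hDb : klDiv (unif M ⊗ₘ (Wb ∘ₖ kof E)) ((unif M).prod (Qm n b P)) ≠ ⊤ := by
    rw [Db, lintegral_unif]
    refine ENNReal.mul_ne_top (by simp) (ENNReal.sum_ne_top.2 fun m _ => ?_)
    rw [Kernel.comp_apply]; exact (hm m).2.1
  have hle : klDiv (unif M ⊗ₘ (Wa ∘ₖ kof E)) ((unif M).prod (Qm n a P))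
      ≤ klDiv (unif M ⊗ₘ (Wb ∘ₖ kof E)) ((unif M).prod (Qm n b P)) + C := by
    rw [Da, Db]
    calc _ ≤ ∫⁻ m, (klDiv ((Wb ∘ₖ kof E) m) (Qm n b P) + C) ∂(unif M) := by
          refine lintegral_mono fun m => ?_
          rw [Kernel.comp_apply, Kernel.comp_apply]; exact (hm m).2.2
      _ = _ := by rw [lintegral_add_right _ measurable_const]; simp
  have hWW : Wb ∘ₖ kof E = κ ∘ₖ (Wa ∘ₖ kof E) := by rw [hW, Kernel.comp_assoc]
  rw [Ca] at hDa hle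
  rw [Cb] at hDb hle
  have hd : klDiv ((Wb ∘ₖ kof E) ∘ₘ unif M) (Qm n b P) ≤ klDiv ((Wa ∘ₖ kof E) ∘ₘ unif M) (Qm n a P) := by
    have := klDiv_comp_right_le ((Wa ∘ₖ kof E) ∘ₘ unif M) (Qm n a P) κ
    rwa [hQ, Measure.comp_assoc, ← hWW] at this
  have fa := ENNReal.add_ne_top.1 hDa
  have fb := ENNReal.add_ne_top.1 hDb
  refine ⟨fa.2, fb.2, ?_, ?_⟩
  · unfold MI
    rw [← hWa, ← hWb, hWW]
    exact klDiv_mi_le _ _ _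
  · refine (ENNReal.add_le_add_iff_left fa.1).1 (hle.trans ?_)
    unfold MI
    rw [← add_assoc]
    gcongr

lemma MI_conv {n : ℕ} {M : Type*} [Fintype M] [Nonempty M] [MeasurableSpace M]
    [StandardBorelSpace M] [MeasurableSingletonClass M] {a b P : ℝ} (ha : 0 ≤ a) (hb : 0 ≤ b) (hP : 0 ≤ P)
    (E : M → Measure (Fin n → ℝ)) [∀ m, IsProbabilityMeasure (E m)]
    (hE : ∀ m, E m {xs | ∑ i, (xs i) ^ 2 ≤ (n : ℝ) * P} = 1) :
    MI a E ≠ ⊤ ∧ MI b E ≠ ⊤ ∧ (MI a E).toReal ≤ (MI b E).toReal + n * Real.log 2 * Cs P a b := by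
  have hl2 : 0 < Real.log 2 := Real.log_pos (by norm_num)
  have hCs : 0 ≤ Cs P a b := le_max_left _ _
  rcases le_total b a with h | h
  · obtain ⟨h1, h2, -, h4⟩ := MI_conv_gt hb h hP E hE
    refine ⟨h1, h2, ?_⟩
    have := ENNReal.toReal_mono (by simp [h2]) h4
    rw [ENNReal.toReal_add h2 (by simp)] at this
    refine this.trans (add_le_add_right (ENNReal.toReal_ofReal'.le.trans (max_le ?_ (by positivity))) _)
    have h5 : (1 / 2) * Real.logb 2 (1 + a * P) - (1 / 2) * Real.logb 2 (1 + b * P) ≤ Cs P a b := le_max_right _ _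
    rw [Real.logb, Real.logb] at h5
    have h6 : n / 2 * (Real.log (1 + a * P) - Real.log (1 + b * P))
      = n * Real.log 2 * ((1 / 2) * (Real.log (1 + a * P) / Real.log 2) - (1 / 2) * (Real.log (1 + b * P) / Real.log 2)) := by
      field_simp
    rw [h6]
    gcongr
  · obtain ⟨h1, h2, h3, -⟩ := MI_conv_gt ha h hP E hE
    refine ⟨h2, h1, ?_⟩
    have := ENNReal.toReal_mono h1 h3
    have : 0 ≤ n * Real.log 2 * Cs P a b := by positivity
    linarith

end WT

namespace WT

open InformationTheory
open scoped NNReal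

lemma meas_dec {M Y : Type*} [Fintype M] [MeasurableSpace M] [MeasurableSingletonClass M]
    [MeasurableSpace Y] (f : Y → M) (hf : Measurable f) :
    MeasurableSet {p : M × Y | f p.2 = p.1} := by
  have : {p : M × Y | f p.2 = p.1} = ⋃ m : M, {m} ×ˢ (f ⁻¹' {m}) := by
    ext p; simp
  rw [this]
  exact MeasurableSet.iUnion fun m => (measurableSet_singleton m).prod (hf (measurableSet_singleton m))

lemma prod_dec {M Y : Type*} [Fintype M] [Nonempty M] [MeasurableSpace M] [MeasurableSingletonClass M]
    [MeasurableSpace Y] (f : Y → M) (hf : Measurable f) (ν : Measure Y) [IsProbabilityMeasure ν] :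
    ((unif M).prod ν).real {p : M × Y | f p.2 = p.1} ≤ 1 / (Fintype.card M : ℝ) := by
  have : ((unif M).prod ν) {p : M × Y | f p.2 = p.1} = (Fintype.card M : ℝ≥0∞)⁻¹ := by
    rw [Measure.prod_apply_symm (meas_dec f hf)]
    have : ∀ y, unif M ((fun x => (x, y)) ⁻¹' {p : M × Y | f p.2 = p.1}) = (Fintype.card M : ℝ≥0∞)⁻¹ := by
      intro y
      have : (fun x => (x, y)) ⁻¹' {p : M × Y | f p.2 = p.1} = {f y} := by ext m; simp [eq_comm]
      rw [this, unif, Measure.smul_apply, Measure.count_singleton]; simp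
    rw [lintegral_congr this]; simp
  rw [measureReal_def, this]
  simp

lemma conv_bound {n : ℕ} {M : Type*} [Fintype M] [Nonempty M] [MeasurableSpace M]
    [StandardBorelSpace M] [MeasurableSingletonClass M] {a b P : ℝ} (ha : 0 ≤ a) (hb : 0 ≤ b) (hP : 0 ≤ P)
    (E : M → Measure (Fin n → ℝ)) [∀ m, IsProbabilityMeasure (E m)]
    (hE : ∀ m, E m {xs | ∑ i, (xs i) ^ 2 ≤ (n : ℝ) * P} = 1) (f : (Fin n → ℝ) → M)
    (hf : Measurable f) (ε : ℝ) (hε : 0 < ε) (hε1 : ε < 1)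
    (h1 : 1 - ε ≤ (unif M ⊗ₘ (gk n (Real.sqrt a) 1 ∘ₖ kof E)).real {p | f p.2 = p.1})
    (h2 : miBits (unif M ⊗ₘ (gk n (Real.sqrt b) 1 ∘ₖ kof E)) ≤ n * ε) :
    (1 - ε) * Real.log (Fintype.card M) + Real.log (1 - ε) + ε * Real.log ε 
      ≤ n * Real.log 2 * (ε + Cs P a b) := by
  obtain ⟨ia, ib, hab⟩ := MI_conv ha hb hP E hE
  rw [miBits_eq _ _ ib, div_le_iff₀ (Real.log_pos (by norm_num))] at h2
  have h3 := fano _ _ ia {p | f p.2 = p.1} (meas_dec f hf) (Fintype.card M) ε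
    (by exact_mod_cast Fintype.card_pos) hε hε1 (prod_dec f hf _) h1
  unfold MI at hab
  linarith

lemma enc1_ball {n K₁ K₂ : ℕ} [NeZero K₂] (enc : Fin K₁ × Fin K₂ → Measure (Fin n → ℝ)) (s : Set (Fin n → ℝ))
    (h : ∀ m, enc m s = 1) (m₁ : Fin K₁) : enc1 enc m₁ s = 1 := by
  simp only [enc1, Measure.smul_apply, Measure.finsetSum_apply, h, Finset.sum_const,
    Finset.card_univ, Fintype.card_fin, nsmul_eq_mul, mul_one, smul_eq_mul]
  rw [ENNReal.inv_mul_cancel (by simp [NeZero.ne]) (by simp)]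

lemma conv_limit {R C : ℝ} (k : ℝ)
    (h : ∀ ε : ℝ, 0 < ε → ε < 1 → (1 - ε) * ((R - k * ε) * Real.log 2) + Real.log (1 - ε) + ε * Real.log ε
      ≤ Real.log 2 * (ε + C)) : R ≤ C := by
  have hl2 : 0 < Real.log 2 := Real.log_pos (by norm_num)
  have t1 : Filter.Tendsto (fun ε : ℝ => (1 - ε) * ((R - k * ε) * Real.log 2) + Real.log (1 - ε) + ε * Real.log ε)
      (nhdsWithin 0 (Set.Ioi 0)) (nhds ((1 - 0) * ((R - k * 0) * Real.log 2) + Real.log (1 - 0) + 0 * Real.log 0)) := by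
    apply Filter.Tendsto.mono_left _ nhdsWithin_le_nhds
    apply Filter.Tendsto.add
    · apply Filter.Tendsto.add
      · exact (by fun_prop : Continuous fun ε : ℝ => (1 - ε) * ((R - k * ε) * Real.log 2)).tendsto 0
      · have : ContinuousAt (fun ε : ℝ => Real.log (1 - ε)) 0 :=
          ContinuousAt.log (by fun_prop) (by norm_num)
        exact this
    · exact Real.continuous_mul_log.tendsto 0
  have t2 : Filter.Tendsto (fun ε : ℝ => Real.log 2 * (ε + C))
      (nhdsWithin 0 (Set.Ioi 0)) (nhds (Real.log 2 * (0 + C))) := by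
    apply Filter.Tendsto.mono_left _ nhdsWithin_le_nhds
    exact (by fun_prop : Continuous fun ε : ℝ => Real.log 2 * (ε + C)).tendsto 0
  have := le_of_tendsto_of_tendsto t1 t2 (by
    filter_upwards [Ioo_mem_nhdsGT (show (0:ℝ) < 1 by norm_num)] with ε hε
    exact h ε hε.1 hε.2)
  simp at this
  nlinarith

lemma conv_arith {n : ℕ} (hn : 0 < n) {R C k ε L : ℝ} (hε : 0 < ε) (hε1 : ε < 1)
    (hR : n * (R - k * ε) ≤ L / Real.log 2) 
    (h : (1 - ε) * L + Real.log (1 - ε) + ε * Real.log ε ≤ n * Real.log 2 * (ε + C)) :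
    (1 - ε) * ((R - k * ε) * Real.log 2) + Real.log (1 - ε) + ε * Real.log ε
      ≤ Real.log 2 * (ε + C) := by
  have hl2 : 0 < Real.log 2 := Real.log_pos (by norm_num)
  rw [le_div_iff₀ hl2] at hR
  have hn' : (1 : ℝ) ≤ n := by exact_mod_cast hn
  have hl1 : Real.log (1 - ε) ≤ 0 := Real.log_nonpos (by linarith) (by linarith)
  have hl0 : ε * Real.log ε ≤ 0 :=
    mul_nonpos_of_nonneg_of_nonpos hε.le (Real.log_nonpos (by linarith) (by linarith))
  have h5 : (1 - ε) * (n * (R - k * ε) * Real.log 2) ≤ (1 - ε) * L :=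
    mul_le_mul_of_nonneg_left hR (by linarith)
  have h6 : (n : ℝ) * (Real.log (1 - ε) + ε * Real.log ε) ≤ Real.log (1 - ε) + ε * Real.log ε := by
    nlinarith
  have : (n : ℝ) * ((1 - ε) * ((R - k * ε) * Real.log 2) + Real.log (1 - ε) + ε * Real.log ε)
      ≤ n * (Real.log 2 * (ε + C)) := by nlinarith
  exact le_of_mul_le_mul_left this (by linarith)

theorem converse (a b₁ b₂ P : ℝ)
    (ha : 0 ≤ a) (hb₁₂ : b₁ ≥ b₂) (hb₂ : b₂ ≥ 0) (hP : 0 ≤ P)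
    (R₁ R₂ : ℝ) (h : GaussAchievable a b₁ b₂ P R₁ R₂) :
    R₁ ≤ Cs P a b₁ ∧ R₁ + R₂ ≤ Cs P a b₂ := by
  have key : ∀ ε : ℝ, 0 < ε → ε < 1 → 
    ((1 - ε) * ((R₁ - 1 * ε) * Real.log 2) + Real.log (1 - ε) + ε * Real.log ε
      ≤ Real.log 2 * (ε + Cs P a b₁)) ∧ ((1 - ε) * ((R₁ + R₂ - 2 * ε) * Real.log 2) + Real.log (1 - ε) + ε * Real.log ε
      ≤ Real.log 2 * (ε + Cs P a b₂)) := by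
    intro ε hε hε1
    obtain ⟨n, hn, K₁, K₂, hK₁, hK₂, hr1, hr2, enc, hp, hball, dec, hdec, herr, hl2, hl1⟩ := h ε hε
    have : NeZero K₁ := ⟨hK₁.ne'⟩
    have : NeZero K₂ := ⟨hK₂.ne'⟩
    have hK₁' : (K₁ : ℝ) ≠ 0 := by exact_mod_cast hK₁.ne'
    have hK₂' : (K₂ : ℝ) ≠ 0 := by exact_mod_cast hK₂.ne'
    have hok : 1 - ε ≤ (unif (Fin K₁ × Fin K₂) ⊗ₘ (gk n (Real.sqrt a) 1 ∘ₖ kof enc)).real {p | dec p.2 = p.1} := by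
      rw [jointLaw_eq] at herr
      have := probReal_compl_eq_one_sub (μ := unif (Fin K₁ × Fin K₂) ⊗ₘ (gk n (Real.sqrt a) 1 ∘ₖ kof enc)) (meas_dec dec hdec)
      have h2 : {p : (Fin K₁ × Fin K₂) × (Fin n → ℝ) | dec p.2 = p.1}ᶜ = {p | dec p.2 ≠ p.1} := rfl
      rw [h2, measureReal_def] at this
      linarith
    constructor
    · have hok1 : 1 - ε ≤ (unif (Fin K₁) ⊗ₘ (gk n (Real.sqrt a) 1 ∘ₖ kof (enc1 enc))).real {p | (dec p.2).1 = p.1} := by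
        refine hok.trans ?_
        rw [← jointLaw_eq, ← jointLaw_map_eq, map_measureReal_apply (by fun_prop) (meas_dec _ hdec.fst)]
        have : IsProbabilityMeasure (jointLaw a enc) := by rw [jointLaw_eq]; infer_instance
        refine measureReal_mono ?_
        intro p hp
        simp only [Set.mem_ofPred_eq, Set.mem_preimage] at hp ⊢
        rw [hp]
      rw [jointLaw_map_eq] at hl1
      have := conv_bound ha (hb₂.le.trans hb₁₂) hP (enc1 enc) (enc1_ball enc _ hball) (fun y => (dec y).1)
        hdec.fst ε hε hε1 hok1 hl1
      rw [Fintype.card_fin] at this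
      refine conv_arith hn hε hε1 ?_ this
      rw [one_mul]; exact hr1
    · rw [jointLaw_eq] at hl2
      have := conv_bound ha hb₂ hP enc hball dec hdec ε hε hε1 hok hl2
      rw [Fintype.card_prod, Fintype.card_fin, Fintype.card_fin] at this
      refine conv_arith hn hε hε1 ?_ this
      push_cast
      rw [Real.log_mul hK₁' hK₂', add_div]
      rw [Real.logb] at hr1 hr2
      linarith
  exact ⟨conv_limit 1 fun ε h1 h2 => (key ε h1 h2).1, conv_limit 2 fun ε h1 h2 => (key ε h1 h2).2⟩

end WT

namespace WT

open InformationTheory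
open scoped NNReal

lemma iid_var {Ω : Type*} [MeasurableSpace Ω] (ρ : Measure Ω) [IsProbabilityMeasure ρ] (h : Ω → ℝ)
    (hh : MemLp h 2 ρ) (n : ℕ) :
    ∫⁻ ω, ENNReal.ofReal ((∑ i, h (ω i) - n * ∫ t, h t ∂ρ) ^ 2) ∂(Measure.pi fun _ : Fin n => ρ)
      = ENNReal.ofReal (n * Var[h; ρ]) := by
  have hv := variance_sum_pi (μ := fun _ : Fin n => ρ) (X := fun _ => h) (fun _ => hh)
  have hc : ∀ i : Fin n, MemLp (fun ω : Fin n → Ω => h (ω i)) 2 (Measure.pi fun _ : Fin n => ρ) :=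
    fun i => hh.comp_measurePreserving (measurePreserving_eval (fun _ : Fin n => ρ) i)
  have hintg : ∀ i : Fin n, ∫ ω : Fin n → Ω, h (ω i) ∂(Measure.pi fun _ : Fin n => ρ) = ∫ t, h t ∂ρ := by
    intro i
    have hp := measurePreserving_eval (fun _ : Fin n => ρ) i
    have := integral_map (μ := Measure.pi fun _ : Fin n => ρ) (φ := Function.eval i)
      hp.measurable.aemeasurable (f := h) (by rw [hp.map_eq]; exact hh.1)
    rw [hp.map_eq] at this
    exact this.symm
  have hmem : MemLp (∑ i : Fin n, fun ω : Fin n → Ω => h (ω i)) 2 (Measure.pi fun _ : Fin n => ρ) :=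
    memLp_finsetSum' _ fun i _ => hc i
  have he := hmem.ofReal_variance_eq
  rw [hv, evariance_eq_lintegral_ofReal] at he
  have hmean : ∫ ω, (∑ i : Fin n, fun ω : Fin n → Ω => h (ω i)) ω ∂(Measure.pi fun _ : Fin n => ρ)
      = n * ∫ t, h t ∂ρ := by
    simp_rw [Finset.sum_apply]
    rw [integral_finsetSum _ fun i _ => (hc i).integrable (by norm_num)]
    simp [hintg]
  rw [hmean] at he
  simp only [Finset.sum_apply, Finset.sum_const, Finset.card_univ, Fintype.card_fin, nsmul_eq_mul] at he
  exact he.symm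

/-- Gaussian iid input law -/
def gi (n : ℕ) (P : ℝ) : Measure (Fin n → ℝ) := Measure.pi fun _ => gaussianReal 0 P.toNNReal

instance (n : ℕ) (P : ℝ) : IsProbabilityMeasure (gi n P) := by unfold gi; infer_instance

instance holder442 : ENNReal.HolderTriple 4 4 2 := ⟨by
  rw [← two_mul]
  have : (4 : ℝ≥0∞) = 2 * 2 := by norm_num
  rw [this, ENNReal.mul_inv (by simp) (by simp), ← mul_assoc, ENNReal.mul_inv_cancel (by simp) (by simp),
    one_mul]⟩

lemma gauss_sq (v : ℝ≥0) : MemLp (fun t : ℝ => t ^ 2) 2 (gaussianReal 0 v) ∧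
    ∫ t, t ^ 2 ∂(gaussianReal 0 v) = v := by
  constructor
  · have h := memLp_id_gaussianReal' (μ := 0) (v := v) 4 (by simp)
    have := MemLp.mul' (r := 2) h h
    simpa [sq] using this
  · have hv := variance_fun_id_gaussianReal (μ := 0) (v := v)
    rwa [variance_of_integral_eq_zero (by fun_prop) (by simp)] at hv

lemma ball_bound {P' P : ℝ} (hP' : 0 ≤ P') (h : P' < P) : ∃ V : ℝ, 0 ≤ V ∧ ∀ n : ℕ, 0 < n →
    gi n P' {xs | ∑ i, (xs i) ^ 2 ≤ (n : ℝ) * P}ᶜ ≤ ENNReal.ofReal (V / n) := by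
  obtain ⟨h1, h2⟩ := gauss_sq P'.toNNReal
  rw [Real.coe_toNNReal _ hP'] at h2
  refine ⟨Var[fun t : ℝ => t ^ 2; gaussianReal 0 P'.toNNReal] / (P - P') ^ 2,
    div_nonneg (variance_nonneg _ _) (sq_nonneg _), fun n hn => ?_⟩
  have h3 := iid_var _ _ h1 n
  rw [h2] at h3
  have hn' : (0 : ℝ) < n := by exact_mod_cast hn
  have hd : 0 < P - P' := by linarith
  have h4 := mul_meas_ge_le_lintegral₀ (μ := Measure.pi fun _ : Fin n => gaussianReal 0 P'.toNNReal)
    (f := fun ω => ENNReal.ofReal ((∑ i, (ω i) ^ 2 - n * P') ^ 2))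
    (by fun_prop : Measurable fun ω : Fin n → ℝ => ENNReal.ofReal ((∑ i, (ω i) ^ 2 - n * P') ^ 2)).aemeasurable
    (ENNReal.ofReal ((n * (P - P')) ^ 2))
  rw [h3] at h4
  have h5 : {xs : Fin n → ℝ | ∑ i, (xs i) ^ 2 ≤ (n : ℝ) * P}ᶜ ⊆
      {x | ENNReal.ofReal ((n * (P - P')) ^ 2) ≤ ENNReal.ofReal ((∑ i, (x i) ^ 2 - n * P') ^ 2)} := by
    intro x hx
    simp only [Set.mem_compl_iff, Set.mem_ofPred_eq, not_le] at hx ⊢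
    apply ENNReal.ofReal_le_ofReal
    apply pow_le_pow_left₀ (by positivity)
    linarith
  refine (measure_mono h5).trans ?_
  have hpos : 0 < (n * (P - P')) ^ 2 := by positivity
  rw [mul_comm, ← ENNReal.le_div_iff_mul_le (.inl (ENNReal.ofReal_pos.2 hpos).ne') (by simp),
    ← ENNReal.ofReal_div_of_pos hpos] at h4
  refine h4.trans (ENNReal.ofReal_le_ofReal (le_of_eq ?_))
  field_simp

lemma ld_var {s P : ℝ} (hs : 0 ≤ s) (hP : 0 ≤ P) : ∃ V : ℝ, 0 ≤ V ∧ ∀ n : ℕ,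
    ∫⁻ p, ENNReal.ofReal ((ld s P p.1 p.2 - n * (1 / 2 * Real.log (1 + s * P))) ^ 2)
      ∂(gi n P ⊗ₘ gk n (Real.sqrt s) 1) ≤ ENNReal.ofReal (n * V) := by
  have hv : 0 < 1 + s * P := by positivity
  set ρ := (gaussianReal 0 P.toNNReal).prod (gaussianReal 0 1) with hρ
  set h : ℝ × ℝ → ℝ := fun p => ld1 s P p.1 (Real.sqrt s * p.1 + p.2) with hh
  have he : h = fun p => 1 / 2 * Real.log (1 + s * P) + (1 / (2 * (1 + s * P)) - 1 / 2) * (1 * p.2 ^ 2)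
        + s / (2 * (1 + s * P)) * (p.1 ^ 2 * 1) + Real.sqrt s / (1 + s * P) * (p.1 * p.2) := by
    ext p
    have : ∀ r : ℝ, r ^ 2 = s → (1 / 2 * Real.log (1 + s * P) - (r * p.1 + p.2 - r * p.1) ^ 2 / 2 + (r * p.1 + p.2) ^ 2 / (2 * (1 + s * P))) = 1 / 2 * Real.log (1 + s * P) + (1 / (2 * (1 + s * P)) - 1 / 2) * (1 * p.2 ^ 2)
        + s / (2 * (1 + s * P)) * (p.1 ^ 2 * 1) + r / (1 + s * P) * (p.1 * p.2) := by
      intro r hr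
      subst hr
      field_simp
      ring
    exact this _ (Real.sq_sqrt hs)
  obtain ⟨x1, x2⟩ := gauss_sq P.toNNReal
  obtain ⟨n1, n2⟩ := gauss_sq 1
  rw [Real.coe_toNNReal _ hP] at x2
  have j1 : MemLp (fun p : ℝ × ℝ => 1 * p.2 ^ 2) 2 ρ := by
    simp only [one_mul]
    exact n1.comp_measurePreserving measurePreserving_snd
  have j2 : MemLp (fun p : ℝ × ℝ => p.1 ^ 2 * 1) 2 ρ := by
    simp only [mul_one]
    exact x1.comp_measurePreserving measurePreserving_fst
  have j3 : MemLp (fun p : ℝ × ℝ => p.1 * p.2) 2 ρ := by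
    have h1 := (memLp_id_gaussianReal' (μ := 0) (v := P.toNNReal) 4 (by simp)).comp_measurePreserving 
      (measurePreserving_fst (μ := gaussianReal 0 P.toNNReal) (ν := gaussianReal 0 1))
    have h2 := (memLp_id_gaussianReal' (μ := 0) (v := 1) 4 (by simp)).comp_measurePreserving 
      (measurePreserving_snd (μ := gaussianReal 0 P.toNNReal) (ν := gaussianReal 0 1))
    exact MemLp.mul' (r := 2) h2 h1
  have l1 := (memLp_const (μ := ρ) (p := 2) (1 / 2 * Real.log (1 + s * P))).add
    (j1.const_mul (1 / (2 * (1 + s * P)) - 1 / 2))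
  have l2 := l1.add (j2.const_mul (s / (2 * (1 + s * P))))
  have l3 := l2.add (j3.const_mul (Real.sqrt s / (1 + s * P)))
  have hmem : MemLp h 2 ρ := by rw [he]; exact l3
  have k1 : ∫ p : ℝ × ℝ, (1:ℝ) * p.2 ^ 2 ∂ρ = 1 := by
    rw [hρ, integral_prod_mul (fun _ => (1:ℝ)) (fun x : ℝ => x ^ 2), n2]; simp
  have k2 : ∫ p : ℝ × ℝ, p.1 ^ 2 * (1:ℝ) ∂ρ = P := by
    rw [hρ, integral_prod_mul (fun x : ℝ => x ^ 2) (fun _ => (1:ℝ)), x2]; simp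
  have k3 : ∫ p : ℝ × ℝ, p.1 * p.2 ∂ρ = 0 := by
    rw [hρ, integral_prod_mul (fun x : ℝ => x) (fun x : ℝ => x)]; simp
  have hmean : ∫ p, h p ∂ρ = 1 / 2 * Real.log (1 + s * P) := by
    rw [he]
    have o : (1 : ℝ≥0∞) ≤ 2 := by norm_num
    refine (integral_add (l2.integrable o) ((j3.const_mul _).integrable o)).trans ?_
    refine (congrArg (· + _) ((integral_add (l1.integrable o) ((j2.const_mul _).integrable o)).trans
      (congrArg (· + _) (integral_add (integrable_const _) ((j1.const_mul _).integrable o))))).trans ?_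
    rw [integral_const_mul (_ - _), integral_const_mul (s / _), integral_const_mul (Real.sqrt s / _), k1, k2, k3, integral_const]
    simp only [probReal_univ, one_smul]
    field_simp
    ring
  refine ⟨Var[h; ρ], variance_nonneg _ _, fun n => ?_⟩
  have hv := iid_var ρ h hmem n
  rw [hmean] at hv
  rw [← hv, compProd_map, lintegral_map (by have := measurable_ld (n := n) s P; fun_prop) (by fun_prop)]
  have hmp := measurePreserving_arrowProdEquivProdArrow ℝ ℝ (Fin n) (fun _ => gaussianReal 0 P.toNNReal)
    (fun _ => gaussianReal 0 1)
  unfold gi nz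
  rw [← hmp.lintegral_comp_emb (MeasurableEquiv.measurableEmbedding _)]
  exact le_of_eq rfl

end WT

namespace WT

open InformationTheory
open scoped NNReal

section abstract_coding
set_option linter.unusedSectionVars false
variable {X Y : Type*} [MeasurableSpace X] [MeasurableSpace Y]

/-- correlation functional of two codewords -/
def psi (Q : Measure Y) (w : X → Y → ℝ≥0) (p : X × X) : ℝ≥0∞ :=
  ∫⁻ y, (w p.1 y : ℝ≥0∞) * w p.2 y ∂Q

/-- resolvability functional of a codeword -/
def phi (Q : Measure Y) (w : X → Y → ℝ≥0) (L : ℝ) (x : X) : ℝ≥0∞ :=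
  ∫⁻ y, (w x y : ℝ≥0∞) * ENNReal.ofReal (Real.log (1 + w x y / L)) ∂Q

/-- missed-detection functional of a codeword -/
def ee (Q : Measure Y) (w : X → Y → ℝ≥0) (T : ℝ≥0) (x : X) : ℝ≥0∞ :=
  ∫⁻ y, {y | w x y ≤ T}.indicator (fun y => (w x y : ℝ≥0∞)) y ∂Q

variable (Q : Measure Y) [IsProbabilityMeasure Q] (w : X → Y → ℝ≥0)

lemma measurable_right (hw : Measurable (fun p : X × Y => w p.1 p.2)) (x : X) : Measurable (w x) :=
  hw.comp (measurable_prodMk_left (x := x))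

lemma measurable_psi (hw : Measurable (fun p : X × Y => w p.1 p.2)) : Measurable (psi Q w) := by
  unfold psi
  refine Measurable.lintegral_prod_right' (f := fun q : (X × X) × Y => (w q.1.1 q.2 : ℝ≥0∞) * w q.1.2 q.2) ?_
  exact ((hw.comp (by fun_prop : Measurable fun q : (X × X) × Y => (q.1.1, q.2))).coe_nnreal_ennreal).mul
    ((hw.comp (by fun_prop : Measurable fun q : (X × X) × Y => (q.1.2, q.2))).coe_nnreal_ennreal)

lemma measurable_phi (hw : Measurable (fun p : X × Y => w p.1 p.2)) (L : ℝ) : Measurable (phi Q w L) := by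
  unfold phi
  refine Measurable.lintegral_prod_right'
    (f := fun q : X × Y => (w q.1 q.2 : ℝ≥0∞) * ENNReal.ofReal (Real.log (1 + w q.1 q.2 / L))) ?_
  have h2 := hw.coe_nnreal_real
  exact hw.coe_nnreal_ennreal.mul (by fun_prop)

lemma measurable_ee (hw : Measurable (fun p : X × Y => w p.1 p.2)) (T : ℝ≥0) : Measurable (ee Q w T) := by
  unfold ee
  exact Measurable.lintegral_prod_right'
    (f := fun q : X × Y => {q : X × Y | w q.1 q.2 ≤ T}.indicator (fun q => (w q.1 q.2 : ℝ≥0∞)) q)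
    (hw.coe_nnreal_ennreal.indicator (measurableSet_le hw measurable_const))

lemma lintegral_psi (hw : Measurable (fun p : X × Y => w p.1 p.2)) (μ : Measure X)
    [IsProbabilityMeasure μ] (W : Kernel X Y) [IsMarkovKernel W]
    (hW : ∀ x, W x = Q.withDensity (fun y => w x y)) (c : ℝ≥0∞)
    (hc : ∀ y, ∫⁻ x, w x y ∂μ ≤ c) : ∫⁻ p, psi Q w p ∂(μ.prod μ) ≤ c := by
  have hw' := hw.coe_nnreal_ennreal
  have h1 : ∀ x, ∫⁻ y, (w x y : ℝ≥0∞) ∂Q = 1 := by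
    intro x
    have : W x Set.univ = 1 := measure_univ
    rwa [hW x, withDensity_apply _ MeasurableSet.univ, setLIntegral_univ] at this
  rw [lintegral_prod _ (measurable_psi Q w hw).aemeasurable]
  calc ∫⁻ x, ∫⁻ x', psi Q w (x, x') ∂μ ∂μ
      = ∫⁻ x, ∫⁻ y, w x y * ∫⁻ x', w x' y ∂μ ∂Q ∂μ := by
        refine lintegral_congr fun x => ?_
        unfold psi
        rw [lintegral_lintegral_swap]
        · refine lintegral_congr fun y => ?_
          dsimp only
          rw [lintegral_const_mul]
          exact hw'.comp (measurable_prodMk_right (y := y))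
        · exact (((hw'.comp (measurable_prodMk_left (x := x))).comp measurable_snd).mul hw').aemeasurable
    _ ≤ ∫⁻ x, ∫⁻ y, w x y * c ∂Q ∂μ := by gcongr with x y; exact hc y
    _ = ∫⁻ x, c ∂μ := by
        refine lintegral_congr fun x => ?_
        rw [lintegral_mul_const _ (measurable_right w hw x).coe_nnreal_ennreal, h1, one_mul]
    _ = c := by simp

lemma lintegral_phi (hw : Measurable (fun p : X × Y => w p.1 p.2)) (μ : Measure X)
    [IsProbabilityMeasure μ] (W : Kernel X Y) [IsMarkovKernel W]
    (hW : ∀ x, W x = Q.withDensity (fun y => w x y)) (L : ℝ) :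
    ∫⁻ x, phi Q w L x ∂μ = ∫⁻ p, ENNReal.ofReal (Real.log (1 + w p.1 p.2 / L)) ∂(μ ⊗ₘ W) := by
  have h2 := hw.coe_nnreal_real
  have hm : Measurable fun p : X × Y => ENNReal.ofReal (Real.log (1 + w p.1 p.2 / L)) := by fun_prop
  rw [Measure.lintegral_compProd hm]
  refine lintegral_congr fun x => ?_
  have hm' : Measurable fun y => ENNReal.ofReal (Real.log (1 + w x y / L)) :=
    hm.comp (measurable_prodMk_left (x := x))
  change phi Q w L x = ∫⁻ y, ENNReal.ofReal (Real.log (1 + w x y / L)) ∂(W x)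
  rw [hW x, lintegral_withDensity_eq_lintegral_mul _ (measurable_right w hw x).coe_nnreal_ennreal
    hm']
  rfl

lemma lintegral_ee (hw : Measurable (fun p : X × Y => w p.1 p.2)) (μ : Measure X)
    [IsProbabilityMeasure μ] (W : Kernel X Y) [IsMarkovKernel W]
    (hW : ∀ x, W x = Q.withDensity (fun y => w x y)) (T : ℝ≥0) :
    ∫⁻ x, ee Q w T x ∂μ = (μ ⊗ₘ W) {p | w p.1 p.2 ≤ T} := by
  have hms : MeasurableSet {p : X × Y | w p.1 p.2 ≤ T} := measurableSet_le hw measurable_const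
  rw [Measure.compProd_apply hms]
  refine lintegral_congr fun x => ?_
  have hms' : MeasurableSet (Prod.mk x ⁻¹' {p : X × Y | w p.1 p.2 ≤ T}) := measurable_prodMk_left hms
  rw [hW x, withDensity_apply _ hms', ← lintegral_indicator hms']
  rfl

lemma pair_map {ι : Type*} [Fintype ι] (μ : Measure X) [IsProbabilityMeasure μ] {i j : ι}
    (hij : i ≠ j) : (Measure.pi fun _ : ι => μ).map (fun C => (C i, C j)) = μ.prod μ := by
  have h := (iIndepFun_pi (μ := fun _ : ι => μ) (X := fun _ => (id : X → X))
    (fun _ => aemeasurable_id)).indepFun hij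
  have h2 : (Measure.pi fun _ : ι => μ).map (fun C => (C i, C j)) =
      ((Measure.pi fun _ : ι => μ).map (fun C => C i)).prod
        ((Measure.pi fun _ : ι => μ).map (fun C => C j)) := (indepFun_iff_map_prod_eq_prod_map_map
    (measurable_pi_apply i).aemeasurable (measurable_pi_apply j).aemeasurable).1 h
  rw [h2]
  have e : ∀ i : ι, (Measure.pi fun _ : ι => μ).map (fun C => C i) = μ :=
    fun i => (measurePreserving_eval (fun _ : ι => μ) i).map_eq
  rw [e, e]

lemma exp_single {ι Λ : Type*} [Fintype ι] [Fintype Λ] (μ : Measure X) [IsProbabilityMeasure μ]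
    (e : Λ → ι) (f : X → ℝ≥0∞) (hf : Measurable f) :
    ∫⁻ C, ∑ l, f (C (e l)) ∂(Measure.pi fun _ : ι => μ) = Fintype.card Λ * ∫⁻ x, f x ∂μ := by
  rw [lintegral_finsetSum _ fun l _ => by fun_prop]
  rw [Finset.sum_congr rfl fun l _ => 
    (measurePreserving_eval (fun _ : ι => μ) (e l)).lintegral_comp hf]
  simp

lemma exp_pair {ι Λ : Type*} [Fintype ι] [Fintype Λ] [DecidableEq Λ] (μ : Measure X) [IsProbabilityMeasure μ]
    (e : Λ → ι) (he : Function.Injective e) (f : X × X → ℝ≥0∞) (hf : Measurable f) :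
    ∫⁻ C, ∑ l, ∑ k with k ≠ l, f (C (e l), C (e k)) ∂(Measure.pi fun _ : ι => μ)
      ≤ (Fintype.card Λ) ^ 2 * ∫⁻ p, f p ∂(μ.prod μ) := by
  rw [lintegral_finsetSum _ fun l _ => Finset.measurable_fun_sum _ fun k _ => by fun_prop]
  have h : ∀ l : Λ, ∫⁻ C, ∑ k with k ≠ l, f (C (e l), C (e k)) ∂(Measure.pi fun _ : ι => μ)
      ≤ Fintype.card Λ * ∫⁻ p, f p ∂(μ.prod μ) := by
    intro l
    rw [lintegral_finsetSum _ fun k _ => by fun_prop]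
    calc _ = ∑ k with k ≠ l, ∫⁻ p, f p ∂(μ.prod μ) := by
          refine Finset.sum_congr rfl fun k hk => ?_
          have hkl : e l ≠ e k := fun hh => (Finset.mem_filter.1 hk).2 (he hh).symm
          rw [← pair_map μ hkl, lintegral_map hf (by fun_prop)]
      _ ≤ ∑ k : Λ, ∫⁻ p, f p ∂(μ.prod μ) :=
          Finset.sum_le_sum_of_subset (Finset.filter_subset _ _)
      _ = _ := by simp
  refine (Finset.sum_le_sum fun l _ => h l).trans ?_
  simp [sq, mul_assoc]

end abstract_coding
end WT

namespace WT

open InformationTheory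
open scoped NNReal

section abstract_leak
set_option linter.unusedSectionVars false
variable {X Y : Type*} [MeasurableSpace X] [MeasurableSpace Y]

lemma klFun_sum_le {Λ : Type*} [Fintype Λ] [DecidableEq Λ] (A : Λ → ℝ) (hA : ∀ l, 0 ≤ A l) :
    klFun (∑ l, A l) ≤ 1 + ∑ l, A l * Real.log (1 + A l) + ∑ l, ∑ k with k ≠ l, A l * A k := by
  have hf0 : 0 ≤ ∑ l, A l := Finset.sum_nonneg fun l _ => hA l
  have key : (∑ l, A l) * Real.log (∑ l, A l)
      ≤ ∑ l, (A l * Real.log (1 + A l) + ∑ k with k ≠ l, A l * A k) := by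
    rw [Finset.sum_mul]
    refine Finset.sum_le_sum fun l _ => ?_
    rcases (hA l).eq_or_lt with h0 | h0
    · simp [← h0]
    · have hS0 : 0 ≤ ∑ k with k ≠ l, A k := Finset.sum_nonneg fun k _ => hA k
      have hsplit : ∑ k, A k = A l + ∑ k with k ≠ l, A k := by
        rw [← Finset.add_sum_erase _ _ (Finset.mem_univ l)]
        congr 2
        ext k; simp
      rw [← Finset.mul_sum, ← mul_add]
      refine mul_le_mul_of_nonneg_left ?_ h0.le
      calc Real.log (∑ k, A k) ≤ Real.log ((1 + A l) * (1 + ∑ k with k ≠ l, A k)) := by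
            apply Real.log_le_log
            · rw [hsplit]; positivity
            · rw [hsplit]; nlinarith [mul_nonneg h0.le hS0]
        _ = Real.log (1 + A l) + Real.log (1 + ∑ k with k ≠ l, A k) :=
            Real.log_mul (by positivity) (by positivity)
        _ ≤ _ := by
            have := Real.log_le_sub_one_of_pos (show 0 < 1 + ∑ k with k ≠ l, A k by positivity)
            linarith
  rw [klFun_apply]
  rw [Finset.sum_add_distrib] at key
  linarith

variable (Q : Measure Y) [IsProbabilityMeasure Q] (w : X → Y → ℝ≥0)

lemma leak {Λ : Type*} [Fintype Λ] [DecidableEq Λ] [Nonempty Λ]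
    (hw : Measurable (fun p : X × Y => w p.1 p.2)) (W : Kernel X Y) [IsMarkovKernel W]
    (hW : ∀ x, W x = Q.withDensity (fun y => w x y)) (c : Λ → X) :
    klDiv ((Fintype.card Λ : ℝ≥0∞)⁻¹ • ∑ l, W (c l)) Q ≤
      1 + (Fintype.card Λ : ℝ≥0∞)⁻¹ * ∑ l, phi Q w (Fintype.card Λ) (c l)
        + ((Fintype.card Λ : ℝ≥0∞)⁻¹)^2 * ∑ l, ∑ k with k ≠ l, psi Q w (c l, c k) := by
  classical
  set N := Fintype.card Λ with hN
  have hN0 : 0 < N := Fintype.card_pos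
  have hNr : (0:ℝ) < N := by exact_mod_cast hN0
  have hwr : ∀ x, Measurable (w x) := fun x => measurable_right w hw x
  set f : Y → ℝ≥0∞ := fun y => (N : ℝ≥0∞)⁻¹ * ∑ l, (w (c l) y : ℝ≥0∞) with hf
  have hfm : Measurable f := by
    refine Measurable.const_mul ?_ _
    exact Finset.measurable_fun_sum _ fun l _ => (hwr _).coe_nnreal_ennreal
  have hμ : (N : ℝ≥0∞)⁻¹ • ∑ l, W (c l) = Q.withDensity f := by
    ext s hs
    rw [Measure.smul_apply, Measure.finsetSum_apply, withDensity_apply _ hs]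
    simp only [hf]
    rw [lintegral_const_mul _ (Finset.measurable_fun_sum _ fun l _ => (hwr _).coe_nnreal_ennreal),
      lintegral_finsetSum _ (fun l _ => (hwr _).coe_nnreal_ennreal), smul_eq_mul]
    congr 1
    refine Finset.sum_congr rfl fun l _ => ?_
    rw [hW, withDensity_apply _ hs]
  have hac : Q.withDensity f ≪ Q := withDensity_absolutelyContinuous _ _
  have hfin : IsFiniteMeasure (Q.withDensity f) := by
    rw [← hμ]
    refine ⟨?_⟩
    rw [Measure.smul_apply, Measure.finsetSum_apply]
    simp only [measure_univ, smul_eq_mul, Finset.sum_const, Finset.card_univ, nsmul_eq_mul, mul_one]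
    rw [← hN, ENNReal.inv_mul_cancel (by simp [hN0.ne']) (by simp)]
    simp
  rw [hμ, klDiv_eq_lintegral_klFun_of_ac hac]
  have hrn := Measure.rnDeriv_withDensity Q hfm
  calc ∫⁻ y, ENNReal.ofReal (klFun ((Q.withDensity f).rnDeriv Q y).toReal) ∂Q
      = ∫⁻ y, ENNReal.ofReal (klFun (f y).toReal) ∂Q := by
        refine lintegral_congr_ae ?_
        filter_upwards [hrn] with y hy
        rw [hy]
    _ ≤ ∫⁻ y, (1 + (N : ℝ≥0∞)⁻¹ * ∑ l, (w (c l) y : ℝ≥0∞) * ENNReal.ofReal (Real.log (1 + w (c l) y / N))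
        + ((N : ℝ≥0∞)⁻¹)^2 * ∑ l, ∑ k with k ≠ l, (w (c l) y : ℝ≥0∞) * w (c k) y) ∂Q := by
        refine lintegral_mono fun y => ?_
        have h := klFun_sum_le (fun l => (w (c l) y : ℝ) / N) (fun l => by positivity)
        have e1 : (f y).toReal = ∑ l, (w (c l) y : ℝ) / N := by
          simp only [hf]
          rw [ENNReal.toReal_mul, ENNReal.toReal_sum (by simp), ← Finset.sum_div]
          simp [div_eq_inv_mul]
        dsimp only
        rw [e1]
        refine (ENNReal.ofReal_le_ofReal h).trans ?_
        have hlog : ∀ l, 0 ≤ Real.log (1 + (w (c l) y : ℝ) / N) := fun l =>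
          Real.log_nonneg (by have : 0 ≤ (w (c l) y : ℝ) / N := by positivity
                              linarith)
        have hinv : ENNReal.ofReal ((N:ℝ)⁻¹) = (N : ℝ≥0∞)⁻¹ := by
          rw [ENNReal.ofReal_inv_of_pos hNr, ENNReal.ofReal_natCast]
        have p1 : 0 ≤ ∑ l, (w (c l) y : ℝ) / N * Real.log (1 + (w (c l) y : ℝ) / N) :=
          Finset.sum_nonneg fun l _ => mul_nonneg (by positivity) (hlog l)
        have p2 : 0 ≤ ∑ l, ∑ k with k ≠ l, (w (c l) y : ℝ) / N * ((w (c k) y : ℝ) / N) :=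
          Finset.sum_nonneg fun l _ => Finset.sum_nonneg fun k _ => by positivity
        rw [ENNReal.ofReal_add (by linarith) p2, ENNReal.ofReal_add zero_le_one p1, ENNReal.ofReal_one]
        apply le_of_eq
        congr 1
        · congr 1
          rw [ENNReal.ofReal_sum_of_nonneg (fun l _ => mul_nonneg (by positivity) (hlog l)), Finset.mul_sum]
          refine Finset.sum_congr rfl fun l _ => ?_
          rw [ENNReal.ofReal_mul (by positivity), div_eq_inv_mul, ENNReal.ofReal_mul (by positivity), hinv,
            ENNReal.ofReal_coe_nnreal, mul_assoc]
        · rw [ENNReal.ofReal_sum_of_nonneg (fun l _ => Finset.sum_nonneg fun k _ => by positivity), Finset.mul_sum]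
          refine Finset.sum_congr rfl fun l _ => ?_
          rw [ENNReal.ofReal_sum_of_nonneg (fun k _ => by positivity), Finset.mul_sum]
          refine Finset.sum_congr rfl fun k _ => ?_
          rw [ENNReal.ofReal_mul (by positivity), div_eq_inv_mul, div_eq_inv_mul,
            ENNReal.ofReal_mul (by positivity), ENNReal.ofReal_mul (by positivity), hinv,
            ENNReal.ofReal_coe_nnreal, ENNReal.ofReal_coe_nnreal]
          ring
    _ = _ := by
        have m1 : ∀ l, Measurable fun y => (w (c l) y : ℝ≥0∞) * ENNReal.ofReal (Real.log (1 + w (c l) y / N)) := by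
          intro l
          have h2 := (hwr (c l)).coe_nnreal_real
          exact (hwr (c l)).coe_nnreal_ennreal.mul (by fun_prop)
        have m2 : ∀ l k, Measurable fun y => (w (c l) y : ℝ≥0∞) * w (c k) y := fun l k =>
          (hwr (c l)).coe_nnreal_ennreal.mul (hwr (c k)).coe_nnreal_ennreal
        have M1 := Finset.measurable_fun_sum Finset.univ fun l _ => m1 l
        have M2' : ∀ l, Measurable fun y => ∑ k with k ≠ l, (w (c l) y : ℝ≥0∞) * w (c k) y := fun l =>
          Finset.measurable_fun_sum _ fun k _ => m2 l k
        have M2 := Finset.measurable_fun_sum Finset.univ fun l _ => M2' l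
        rw [lintegral_add_right _ (M2.const_mul _), lintegral_add_right _ (M1.const_mul _),
          lintegral_const_mul _ M1, lintegral_const_mul _ M2, lintegral_finsetSum _ (fun l _ => m1 l),
          lintegral_finsetSum _ (fun l _ => M2' l)]
        simp only [lintegral_const, measure_univ, mul_one]
        congr 2
        refine Finset.sum_congr rfl fun l _ => ?_
        rw [lintegral_finsetSum _ (fun k _ => m2 l k)]
        rfl

/-- threshold decoder -/
lemma decoder {ι M : Type*} [Fintype ι] [DecidableEq ι] [Nonempty ι]
    [MeasurableSpace M]
    (hw : Measurable (fun p : X × Y => w p.1 p.2)) (W : Kernel X Y) [IsMarkovKernel W]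
    (hW : ∀ x, W x = Q.withDensity (fun y => w x y)) (c : ι → X) (T : ℝ≥0) (hT : 0 < T)
    (g : ι → M) :
    ∃ dec : Y → M, Measurable dec ∧ ∀ i, W (c i) {y | dec y ≠ g i} ≤
      ee Q w T (c i) + (T : ℝ≥0∞)⁻¹ * ∑ j with j ≠ i, psi Q w (c i, c j) := by
  have hwr : ∀ x, Measurable (w x) := fun x => measurable_right w hw x
  let G : ι → Set Y := fun i => {y | T < w (c i) y} ∩ ⋂ j ∈ ({j | j ≠ i} : Set ι), {y | w (c j) y ≤ T}
  have hG : ∀ i, MeasurableSet (G i) := fun i =>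
    (measurableSet_lt measurable_const (hwr _)).inter
      (MeasurableSet.biInter (Set.to_countable _) fun j _ => measurableSet_le (hwr _) measurable_const)
  obtain ⟨dec, hdm, hd⟩ := exists_measurable_piecewise G hG (fun i _ => g i) (fun i => measurable_const) (by
    intro i j hij y hy
    exfalso
    have h1 : T < w (c i) y := hy.1.1
    have h2 : w (c i) y ≤ T := Set.mem_iInter₂.1 hy.2.2 i hij
    exact absurd h1 (not_lt.2 h2))
  refine ⟨dec, hdm, fun i => ?_⟩
  have hsub : {y | dec y ≠ g i} ⊆ {y | w (c i) y ≤ T} ∪ ⋃ j ∈ Finset.univ.filter (fun j => j ≠ i), {y | T < w (c j) y} := by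
    intro y hy
    by_contra hcon
    rw [Set.mem_union, not_or] at hcon
    refine hy (hd i ⟨(not_le.1 (show ¬ w (c i) y ≤ T from hcon.1) : T < w (c i) y), ?_⟩)
    refine Set.mem_iInter₂.2 fun j hj => ?_
    have h2 := hcon.2
    simp only [Set.mem_iUnion, not_exists] at h2
    exact not_lt.1 (show ¬ T < w (c j) y from h2 j (by simpa using hj))
  refine (measure_mono hsub).trans ((measure_union_le _ _).trans ?_)
  gcongr
  · have hs := measurableSet_le (hwr (c i)) (measurable_const (a := T))
    rw [hW, withDensity_apply _ hs, ← lintegral_indicator hs]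
    rfl
  · refine (measure_biUnion_finset_le _ _).trans ?_
    rw [Finset.mul_sum]
    refine Finset.sum_le_sum fun j _ => ?_
    have hs := measurableSet_lt (measurable_const (a := T)) (hwr (c j))
    have hTne : (T : ℝ≥0∞) ≠ 0 := by exact_mod_cast hT.ne'
    unfold psi
    rw [hW, withDensity_apply _ hs, ← lintegral_indicator hs,
      ← lintegral_const_mul _ (show Measurable fun y => (w (c i) y : ℝ≥0∞) * w (c j) y from
        (hwr (c i)).coe_nnreal_ennreal.mul (hwr (c j)).coe_nnreal_ennreal)]
    refine lintegral_mono fun y => ?_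
    by_cases hy : y ∈ {y | T < w (c j) y}
    swap
    · rw [Set.indicator_of_notMem hy]; exact zero_le
    rw [Set.indicator_of_mem hy]
    have hy' : (T : ℝ≥0∞) ≤ w (c j) y := by exact_mod_cast (le_of_lt (show T < w (c j) y from hy))
    calc (w (c i) y : ℝ≥0∞) = (T : ℝ≥0∞)⁻¹ * (w (c i) y * T) := by
          rw [mul_comm (w (c i) y : ℝ≥0∞), ← mul_assoc, ENNReal.inv_mul_cancel hTne (by simp), one_mul]
      _ ≤ _ := by gcongr

end abstract_leak
end WT

namespace WT

open InformationTheory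
open scoped NNReal

section random_code
set_option linter.unusedSectionVars false
variable {X Y : Type*} [MeasurableSpace X] [MeasurableSpace Y]

/-- leakage bound of a group of codewords -/
def leakF {Λ : Type*} [Fintype Λ] [DecidableEq Λ] (Q : Measure Y) (w : X → Y → ℝ≥0) (c : Λ → X) :
    ℝ≥0∞ :=
  1 + (Fintype.card Λ : ℝ≥0∞)⁻¹ * ∑ l, phi Q w (Fintype.card Λ) (c l)
        + ((Fintype.card Λ : ℝ≥0∞)⁻¹)^2 * ∑ l, ∑ k with k ≠ l, psi Q w (c l, c k)

/-- average error bound of a codebook -/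
def errF {ι : Type*} [Fintype ι] [DecidableEq ι] (Q : Measure Y) (w : X → Y → ℝ≥0) (T : ℝ≥0)
    (c : ι → X) : ℝ≥0∞ :=
  (Fintype.card ι : ℝ≥0∞)⁻¹ *
    ∑ i, (ee Q w T (c i) + (T : ℝ≥0∞)⁻¹ * ∑ j with j ≠ i, psi Q w (c i, c j))

variable (Q : Measure Y) [IsProbabilityMeasure Q] (w : X → Y → ℝ≥0)

lemma measurable_sum_psi {ι Λ : Type*} [Fintype ι] [Fintype Λ] [DecidableEq Λ]
    (hw : Measurable (fun p : X × Y => w p.1 p.2)) (e : Λ → ι) (l : Λ) :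
    Measurable fun C : ι → X => ∑ k with k ≠ l, psi Q w (C (e l), C (e k)) := by
  have := measurable_psi Q w hw
  exact Finset.measurable_fun_sum _ fun k _ => by fun_prop

lemma measurable_leakF {ι Λ : Type*} [Fintype ι] [Fintype Λ] [DecidableEq Λ]
    (hw : Measurable (fun p : X × Y => w p.1 p.2)) (e : Λ → ι) :
    Measurable fun C : ι → X => leakF Q w (fun l => C (e l)) := by
  unfold leakF
  have h1 := measurable_phi Q w hw (Fintype.card Λ)
  have m1 : Measurable fun C : ι → X => ∑ l, phi Q w (Fintype.card Λ) (C (e l)) :=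
    Finset.measurable_fun_sum _ fun l _ => by fun_prop
  have m2 : Measurable fun C : ι → X => ∑ l, ∑ k with k ≠ l, psi Q w (C (e l), C (e k)) :=
    Finset.measurable_fun_sum _ fun l _ => measurable_sum_psi Q w hw e l
  exact (measurable_const.add (m1.const_mul _)).add (m2.const_mul _)

lemma measurable_errF {ι : Type*} [Fintype ι] [DecidableEq ι]
    (hw : Measurable (fun p : X × Y => w p.1 p.2)) (T : ℝ≥0) :
    Measurable fun C : ι → X => errF Q w T C := by
  unfold errF
  have h1 := measurable_ee Q w hw T
  refine Measurable.const_mul ?_ _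
  exact Finset.measurable_fun_sum _ fun l _ =>
    (by fun_prop : Measurable fun C : ι → X => ee Q w T (C l)).add
      ((measurable_sum_psi Q w hw id l).const_mul _)

lemma exp_leakF {ι Λ : Type*} [Fintype ι] [Fintype Λ] [DecidableEq Λ] [Nonempty Λ]
    (hw : Measurable (fun p : X × Y => w p.1 p.2)) (μ : Measure X)
    [IsProbabilityMeasure μ] (W : Kernel X Y) [IsMarkovKernel W]
    (hW : ∀ x, W x = Q.withDensity (fun y => w x y)) (c : ℝ≥0∞)
    (hc : ∀ y, ∫⁻ x, w x y ∂μ ≤ c) (e : Λ → ι) (he : Function.Injective e) :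
    ∫⁻ C, leakF Q w (fun l => C (e l)) ∂(Measure.pi fun _ : ι => μ)
      ≤ 1 + ∫⁻ x, phi Q w (Fintype.card Λ) x ∂μ + c := by
  unfold leakF
  have h1 := measurable_phi Q w hw (Fintype.card Λ)
  have hN0 : (Fintype.card Λ : ℝ≥0∞) ≠ 0 := by simp
  have hNt : (Fintype.card Λ : ℝ≥0∞) ≠ ⊤ := by simp
  have m1 : Measurable fun C : ι → X => ∑ l, phi Q w (Fintype.card Λ) (C (e l)) :=
    Finset.measurable_fun_sum _ fun l _ => by fun_prop
  have m2 : Measurable fun C : ι → X => ∑ l, ∑ k with k ≠ l, psi Q w (C (e l), C (e k)) :=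
    Finset.measurable_fun_sum _ fun l _ => measurable_sum_psi Q w hw e l
  rw [lintegral_add_right _ (m2.const_mul _), lintegral_add_right _ (m1.const_mul _),
    lintegral_const_mul _ m1, lintegral_const_mul _ m2, exp_single μ e _ h1]
  simp only [lintegral_const, measure_univ, mul_one]
  rw [← mul_assoc, ENNReal.inv_mul_cancel hN0 hNt, one_mul]
  gcongr
  calc _ ≤ ((Fintype.card Λ : ℝ≥0∞)⁻¹)^2 * ((Fintype.card Λ : ℝ≥0∞)^2 * c) := by
        gcongr
        exact (exp_pair μ e he _ (measurable_psi Q w hw)).trans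
          (by gcongr; exact lintegral_psi Q w hw μ W hW c hc)
    _ = c := by
        rw [← mul_assoc, ← mul_pow, ENNReal.inv_mul_cancel hN0 hNt, one_pow, one_mul]

lemma exp_errF {ι : Type*} [Fintype ι] [DecidableEq ι] [Nonempty ι]
    (hw : Measurable (fun p : X × Y => w p.1 p.2)) (μ : Measure X)
    [IsProbabilityMeasure μ] (W : Kernel X Y) [IsMarkovKernel W]
    (hW : ∀ x, W x = Q.withDensity (fun y => w x y)) (c : ℝ≥0∞)
    (hc : ∀ y, ∫⁻ x, w x y ∂μ ≤ c) (T : ℝ≥0) :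
    ∫⁻ C, errF Q w T C ∂(Measure.pi fun _ : ι => μ)
      ≤ (μ ⊗ₘ W) {p | w p.1 p.2 ≤ T} + (T : ℝ≥0∞)⁻¹ * (Fintype.card ι * c) := by
  unfold errF
  have h1 := measurable_ee Q w hw T
  have hN0 : (Fintype.card ι : ℝ≥0∞) ≠ 0 := by simp
  have hNt : (Fintype.card ι : ℝ≥0∞) ≠ ⊤ := by simp
  have m1 : Measurable fun C : ι → X => ∑ l, ee Q w T (C l) :=
    Finset.measurable_fun_sum _ fun l _ => by fun_prop
  have m2 : Measurable fun C : ι → X => ∑ l, ∑ k with k ≠ l, psi Q w (C l, C k) :=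
    Finset.measurable_fun_sum _ fun l _ => measurable_sum_psi Q w hw id l
  simp_rw [Finset.sum_add_distrib, ← Finset.mul_sum]
  rw [lintegral_const_mul _ (show Measurable fun C : ι → X => ∑ l, ee Q w T (C l) +
      (T : ℝ≥0∞)⁻¹ * ∑ l, ∑ k with k ≠ l, psi Q w (C l, C k) from m1.add (m2.const_mul _)),
    lintegral_add_right _ (m2.const_mul _),
    lintegral_const_mul _ m2]
  have e1 := exp_single μ (id : ι → ι) _ h1
  have e2 := (exp_pair μ (id : ι → ι) Function.injective_id _ (measurable_psi Q w hw)).trans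
    (mul_le_mul_right (lintegral_psi Q w hw μ W hW c hc) _)
  simp only [id] at e1 e2
  rw [e1, lintegral_ee Q w hw μ W hW T, mul_add, ← mul_assoc, ENNReal.inv_mul_cancel hN0 hNt, one_mul]
  refine add_le_add le_rfl ?_
  calc _ ≤ (Fintype.card ι : ℝ≥0∞)⁻¹ * ((T : ℝ≥0∞)⁻¹ * ((Fintype.card ι : ℝ≥0∞)^2 * c)) := by gcongr
    _ = ((Fintype.card ι : ℝ≥0∞)⁻¹ * Fintype.card ι) * ((T : ℝ≥0∞)⁻¹ * ((Fintype.card ι : ℝ≥0∞) * c)) := by ring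
    _ = _ := by rw [ENNReal.inv_mul_cancel hN0 hNt, one_mul]

lemma avg_le {M Ω : Type*} [Fintype M] [Nonempty M] [MeasurableSpace Ω] (μ : Measure Ω)
    (f : M → Ω → ℝ≥0∞) (hf : ∀ m, Measurable (f m)) (B : ℝ≥0∞) (h : ∀ m, ∫⁻ x, f m x ∂μ ≤ B) :
    ∫⁻ x, (Fintype.card M : ℝ≥0∞)⁻¹ * ∑ m, f m x ∂μ ≤ B := by
  rw [lintegral_const_mul _ (Finset.measurable_fun_sum _ fun m _ => hf m),
    lintegral_finsetSum _ fun m _ => hf m]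
  calc _ ≤ (Fintype.card M : ℝ≥0∞)⁻¹ * ∑ m : M, B := by gcongr; exact h _
    _ = B := by
      simp only [Finset.sum_const, Finset.card_univ, nsmul_eq_mul]
      rw [← mul_assoc, ENNReal.inv_mul_cancel (by simp) (by simp), one_mul]

lemma choose3 {Ω : Type*} [MeasurableSpace Ω] (μ : Measure Ω) [IsProbabilityMeasure μ]
    (N : Set Ω) (hN : μ N = 0) (G₀ G₁ G₂ : Ω → ℝ≥0∞) (h₀ : Measurable G₀) (h₁ : Measurable G₁)
    (h₂ : Measurable G₂) (e₀ e₁ e₂ : ℝ) (p₀ : 0 < e₀) (p₁ : 0 < e₁) (p₂ : 0 < e₂)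
    (b₀ : ∫⁻ x, G₀ x ∂μ ≤ ENNReal.ofReal (e₀ / 3)) (b₁ : ∫⁻ x, G₁ x ∂μ ≤ ENNReal.ofReal (e₁ / 3))
    (b₂ : ∫⁻ x, G₂ x ∂μ ≤ ENNReal.ofReal (e₂ / 3)) :
    ∃ x, x ∉ N ∧ G₀ x ≤ ENNReal.ofReal e₀ ∧ G₁ x ≤ ENNReal.ofReal e₁ ∧ G₂ x ≤ ENNReal.ofReal e₂ := by
  have key : ∀ e : ℝ, 0 < e → ENNReal.ofReal e⁻¹ * ENNReal.ofReal (e / 3) = ENNReal.ofReal (1 / 3) := by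
    intro e he
    rw [← ENNReal.ofReal_mul (by positivity)]
    congr 1; field_simp
  obtain ⟨x, hx, hle⟩ := exists_notMem_null_le_lintegral (μ := μ)
    (f := fun x => ENNReal.ofReal e₀⁻¹ * G₀ x + ENNReal.ofReal e₁⁻¹ * G₁ x + ENNReal.ofReal e₂⁻¹ * G₂ x)
    (N := N) (by fun_prop) hN
  rw [lintegral_add_right _ (by fun_prop), lintegral_add_right _ (by fun_prop),
    lintegral_const_mul _ h₀, lintegral_const_mul _ h₁, lintegral_const_mul _ h₂] at hle
  have h1 : ENNReal.ofReal e₀⁻¹ * G₀ x + ENNReal.ofReal e₁⁻¹ * G₁ x + ENNReal.ofReal e₂⁻¹ * G₂ x ≤ 1 := by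
    refine hle.trans ?_
    calc _ ≤ ENNReal.ofReal e₀⁻¹ * ENNReal.ofReal (e₀ / 3) + ENNReal.ofReal e₁⁻¹ * ENNReal.ofReal (e₁ / 3)
          + ENNReal.ofReal e₂⁻¹ * ENNReal.ofReal (e₂ / 3) := by gcongr
      _ = 1 := by
        rw [key _ p₀, key _ p₁, key _ p₂, ← ENNReal.ofReal_add (by norm_num) (by norm_num),
          ← ENNReal.ofReal_add (by norm_num) (by norm_num)]
        norm_num
  have fin : ∀ (e : ℝ) (g : ℝ≥0∞), 0 < e → ENNReal.ofReal e⁻¹ * g ≤ 1 → g ≤ ENNReal.ofReal e := by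
    intro e g he hg
    calc g = ENNReal.ofReal e * (ENNReal.ofReal e⁻¹ * g) := by
          rw [← mul_assoc, ← ENNReal.ofReal_mul he.le, mul_inv_cancel₀ he.ne', ENNReal.ofReal_one, one_mul]
      _ ≤ ENNReal.ofReal e * 1 := by gcongr
      _ = _ := mul_one _
  refine ⟨x, hx, fin _ _ p₀ (le_trans ?_ h1), fin _ _ p₁ (le_trans ?_ h1), fin _ _ p₂ (le_trans ?_ h1)⟩
  · rw [add_assoc]; exact le_self_add
  · exact le_trans le_add_self le_self_add
  · exact le_add_self

end random_code

lemma miBits_le {M Y : Type*} [Fintype M] [Nonempty M] [MeasurableSpace M] [MeasurableSingletonClass M]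
    [StandardBorelSpace M] [MeasurableSpace Y] (κ : Kernel M Y) [IsMarkovKernel κ]
    (Q : Measure Y) [IsProbabilityMeasure Q] (hac : ∀ m, κ m ≪ Q) (d : ℝ) (hd : 0 ≤ d)
    (h : (Fintype.card M : ℝ≥0∞)⁻¹ * ∑ m, klDiv (κ m) Q ≤ ENNReal.ofReal (d * Real.log 2)) :
    miBits (unif M ⊗ₘ κ) ≤ d := by
  have h1 := klDiv_avg (unif M) κ Q hac
  rw [lintegral_unif] at h1
  have h2 := klDiv_compens (unif M) κ Q
  have h3 : klDiv (unif M ⊗ₘ κ) ((unif M).prod (κ ∘ₘ unif M)) ≤ ENNReal.ofReal (d * Real.log 2) := by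
    refine le_trans ?_ h
    rw [← h1, h2]
    exact le_add_self
  have hl : 0 < Real.log 2 := Real.log_pos (by norm_num)
  rw [miBits_eq _ _ (ne_top_of_le_ne_top (by simp) h3), div_le_iff₀ hl]
  exact ENNReal.toReal_le_of_le_ofReal (by positivity) h3

end WT

namespace WT

open InformationTheory
open scoped NNReal

/-- likelihood ratio, real valued -/
def wn {n : ℕ} (s P : ℝ) (x y : Fin n → ℝ) : ℝ≥0 := (Real.exp (ld s P x y)).toNNReal

lemma wn_coe {n : ℕ} (s P : ℝ) (x y : Fin n → ℝ) : (wn s P x y : ℝ≥0∞) = lr s P x y := rfl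

lemma wn_real {n : ℕ} (s P : ℝ) (x y : Fin n → ℝ) : (wn s P x y : ℝ) = Real.exp (ld s P x y) :=
  Real.coe_toNNReal _ (Real.exp_pos _).le

lemma measurable_wn {n : ℕ} (s P : ℝ) :
    Measurable (fun p : (Fin n → ℝ) × (Fin n → ℝ) => wn s P p.1 p.2) :=
  measurable_real_toNNReal.comp (Real.measurable_exp.comp (measurable_ld s P))

lemma wn_dens {n : ℕ} {s P : ℝ} (hs : 0 ≤ s) (hP : 0 ≤ P) (x : Fin n → ℝ) :
    gk n (Real.sqrt s) 1 x = (Qm n s P).withDensity (fun y => wn s P x y) := gk_dens hs hP x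

/-- power ball -/
def pb (n : ℕ) (P : ℝ) : Set (Fin n → ℝ) := {xs | ∑ i, (xs i) ^ 2 ≤ (n : ℝ) * P}

lemma measurableSet_pb (n : ℕ) (P : ℝ) : MeasurableSet (pb n P) := measurableSet_pball n P

/-- truncated Gaussian input law -/
def tg (n : ℕ) (P' P : ℝ) : Measure (Fin n → ℝ) :=
  (gi n P' (pb n P))⁻¹ • (gi n P').restrict (pb n P)

lemma tg_prob {n : ℕ} {P' P : ℝ} (h : (2:ℝ≥0∞)⁻¹ ≤ gi n P' (pb n P)) : IsProbabilityMeasure (tg n P' P) := by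
  constructor
  rw [tg, Measure.smul_apply, Measure.restrict_apply MeasurableSet.univ, Set.univ_inter, smul_eq_mul]
  refine ENNReal.inv_mul_cancel ?_ (measure_ne_top _ _)
  intro h0
  rw [h0] at h
  simp at h

lemma tg_null {n : ℕ} {P' P : ℝ} : tg n P' P (pb n P)ᶜ = 0 := by
  rw [tg, Measure.smul_apply, Measure.restrict_apply (measurableSet_pb n P).compl]
  simp

lemma tg_le {n : ℕ} {P' P : ℝ} (h : (2:ℝ≥0∞)⁻¹ ≤ gi n P' (pb n P)) (f : (Fin n → ℝ) → ℝ≥0∞) :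
    ∫⁻ x, f x ∂(tg n P' P) ≤ 2 * ∫⁻ x, f x ∂(gi n P') := by
  rw [tg, lintegral_smul_measure, smul_eq_mul]
  gcongr
  · have := ENNReal.inv_le_inv.2 h
    rwa [inv_inv] at this
  · exact Measure.restrict_le_self

lemma tg_le_compProd {n : ℕ} {P' P : ℝ} (h : (2:ℝ≥0∞)⁻¹ ≤ gi n P' (pb n P))
    (W : Kernel (Fin n → ℝ) (Fin n → ℝ)) [IsMarkovKernel W]
    (f : (Fin n → ℝ) × (Fin n → ℝ) → ℝ≥0∞) (hf : Measurable f) :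
    ∫⁻ p, f p ∂(tg n P' P ⊗ₘ W) ≤ 2 * ∫⁻ p, f p ∂(gi n P' ⊗ₘ W) := by
  have := tg_prob h
  rw [Measure.lintegral_compProd hf, Measure.lintegral_compProd hf]
  exact tg_le h _

lemma tg_lr {n : ℕ} {s P' P : ℝ} (hs : 0 ≤ s) (hP' : 0 < P')
    (h : (2:ℝ≥0∞)⁻¹ ≤ gi n P' (pb n P)) (y : Fin n → ℝ) :
    ∫⁻ x, wn s P' x y ∂(tg n P' P) ≤ 2 := by
  refine (tg_le h _).trans ?_
  have := lint_lr (n := n) hs hP' y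
  simp only [wn_coe]
  rw [gi, this, mul_one]

lemma log_one_add_le (t A : ℝ) : Real.log (1 + Real.exp t / Real.exp A) ≤ Real.log 2 + max (t - A) 0 := by
  rw [← Real.exp_sub, ← Real.log_exp (max (t - A) 0), ← Real.log_mul (by norm_num) (Real.exp_pos _).ne']
  apply Real.log_le_log (by positivity)
  have h1 : Real.exp (t - A) ≤ Real.exp (max (t - A) 0) := Real.exp_le_exp.2 (le_max_left _ _)
  have h2 : 1 ≤ Real.exp (max (t - A) 0) := Real.one_le_exp (le_max_right _ _)
  linarith

lemma phi_bound {s P : ℝ} (hs : 0 ≤ s) (hP : 0 ≤ P) : ∃ V : ℝ, 0 ≤ V ∧ ∀ n : ℕ, 0 < n → ∀ η : ℝ, 0 < η →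
    ∀ L : ℝ, 0 < L →
    ∫⁻ p, ENNReal.ofReal (Real.log (1 + wn s P p.1 p.2 / L)) ∂(gi n P ⊗ₘ gk n (Real.sqrt s) 1) ≤
      ENNReal.ofReal (Real.log 2 + n * η + V / η + max (n * (1 / 2 * Real.log (1 + s * P)) - Real.log L) 0) := by
  obtain ⟨V, hV, h⟩ := ld_var hs hP
  refine ⟨V, hV, fun n hn η hη L hL => ?_⟩
  have hn' : (0:ℝ) < n := by exact_mod_cast hn
  have hl2 : 0 < Real.log 2 := Real.log_pos (by norm_num)
  set I := 1 / 2 * Real.log (1 + s * P) with hI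
  set m := max (n * I - Real.log L) 0 with hm
  have hm0 : 0 ≤ m := le_max_right _ _
  have hmeas : Measurable fun p : (Fin n → ℝ) × (Fin n → ℝ) =>
      ENNReal.ofReal ((ld s P p.1 p.2 - n * I) ^ 2) := by
    have := measurable_ld (n := n) s P
    fun_prop
  calc _ ≤ ∫⁻ p, (ENNReal.ofReal (Real.log 2 + n * η + m) + ENNReal.ofReal ((n * η)⁻¹) *
        ENNReal.ofReal ((ld s P p.1 p.2 - n * I) ^ 2)) ∂(gi n P ⊗ₘ gk n (Real.sqrt s) 1) := by
        refine lintegral_mono fun p => ?_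
        dsimp only
        rw [← ENNReal.ofReal_mul (by positivity), ← ENNReal.ofReal_add (by positivity) (by positivity)]
        apply ENNReal.ofReal_le_ofReal
        rw [wn_real]
        have h1 := log_one_add_le (ld s P p.1 p.2) (Real.log L)
        rw [Real.exp_log hL] at h1
        refine h1.trans ?_
        set u := ld s P p.1 p.2 - n * I with hu
        have h2 : |u| ≤ n * η + (n * η)⁻¹ * u ^ 2 := by
          have hne : 0 < n * η := by positivity
          have h3 : |u| * (n * η) ≤ (n * η + (n * η)⁻¹ * u ^ 2) * (n * η) := by
            have : (n * η + (n * η)⁻¹ * u ^ 2) * (n * η) = (n * η) ^ 2 + u ^ 2 := by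
              field_simp
            rw [this, ← sq_abs u]
            nlinarith [sq_nonneg (|u| - n * η), abs_nonneg u]
          exact le_of_mul_le_mul_right h3 hne
        have h4 : max (ld s P p.1 p.2 - Real.log L) 0 ≤ |u| + m := by
          apply max_le
          · have := le_max_left (n * I - Real.log L) 0
            have := le_abs_self u
            linarith
          · positivity
        linarith
    _ ≤ ENNReal.ofReal (Real.log 2 + n * η + m) + ENNReal.ofReal ((n * η)⁻¹) * ENNReal.ofReal (n * V) := by
        rw [lintegral_add_right _ (hmeas.const_mul _), lintegral_const_mul _ hmeas]
        simp only [lintegral_const, measure_univ, mul_one]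
        gcongr
        exact h n
    _ = _ := by
        rw [← ENNReal.ofReal_mul (by positivity), ← ENNReal.ofReal_add (by positivity) (by positivity)]
        congr 1
        field_simp
        ring

lemma err_bound {s P : ℝ} (hs : 0 ≤ s) (hP : 0 ≤ P) : ∃ V : ℝ, 0 ≤ V ∧ ∀ n : ℕ, 0 < n → ∀ δ : ℝ, 0 < δ →
    (gi n P ⊗ₘ gk n (Real.sqrt s) 1)
      {p | wn s P p.1 p.2 ≤ (Real.exp (n * (1 / 2 * Real.log (1 + s * P) - δ))).toNNReal} ≤
      ENNReal.ofReal (V / (n * δ ^ 2)) := by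
  obtain ⟨V, hV, h⟩ := ld_var hs hP
  refine ⟨V, hV, fun n hn δ hδ => ?_⟩
  have hn' : (0:ℝ) < n := by exact_mod_cast hn
  set I := 1 / 2 * Real.log (1 + s * P) with hI
  have hmeas : Measurable fun p : (Fin n → ℝ) × (Fin n → ℝ) =>
      ENNReal.ofReal ((ld s P p.1 p.2 - n * I) ^ 2) := by
    have := measurable_ld (n := n) s P
    fun_prop
  have hsub : {p : (Fin n → ℝ) × (Fin n → ℝ) | wn s P p.1 p.2 ≤ (Real.exp (n * (I - δ))).toNNReal} ⊆
      {p | ENNReal.ofReal ((n * δ) ^ 2) ≤ ENNReal.ofReal ((ld s P p.1 p.2 - n * I) ^ 2)} := by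
    intro p hp
    have h1 : (wn s P p.1 p.2 : ℝ) ≤ ((Real.exp (n * (I - δ))).toNNReal : ℝ) := NNReal.coe_le_coe.2 hp
    rw [wn_real, Real.coe_toNNReal _ (Real.exp_pos _).le, Real.exp_le_exp] at h1
    apply ENNReal.ofReal_le_ofReal
    have : 0 < n * δ := by positivity
    nlinarith
  refine (measure_mono hsub).trans ?_
  refine (meas_ge_le_lintegral_div hmeas.aemeasurable (ENNReal.ofReal_pos.2 (by positivity)).ne' (by simp)).trans ?_
  calc _ ≤ ENNReal.ofReal (n * V) / ENNReal.ofReal ((n * δ) ^ 2) := by gcongr; exact h n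
    _ = _ := by
      rw [← ENNReal.ofReal_div_of_pos (by positivity)]
      congr 1
      field_simp

end WT

namespace WT

open InformationTheory
open scoped NNReal

lemma miBits_subsingleton {M Y : Type*} [Fintype M] [Nonempty M] [Subsingleton M] [MeasurableSpace M]
    [MeasurableSingletonClass M] [StandardBorelSpace M] [MeasurableSpace Y] (κ : Kernel M Y)
    [IsMarkovKernel κ] : miBits (unif M ⊗ₘ κ) ≤ 0 := by
  obtain ⟨m₀⟩ := ‹Nonempty M›
  have hm : ∀ m, m = m₀ := fun m => Subsingleton.elim _ _
  refine miBits_le κ (κ m₀) (fun m => by rw [hm m]) 0 le_rfl ?_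
  have : ∀ m, klDiv (κ m) (κ m₀) = 0 := fun m => by rw [hm m]; simp
  simp [this]

lemma comp_avg_dirac {X Y Λ : Type*} [Fintype Λ] [MeasurableSpace X] [MeasurableSpace Y] (W : Kernel X Y)
    (c : Λ → X) (r : ℝ≥0∞) :
    W ∘ₘ (r • ∑ l, Measure.dirac (c l)) = r • ∑ l, W (c l) := by
  ext s hs
  rw [Measure.bind_apply hs (Kernel.aemeasurable _), lintegral_smul_measure,
    lintegral_finsetSum_measure, Measure.smul_apply, Measure.finsetSum_apply]
  congr 1
  refine Finset.sum_congr rfl fun l _ => ?_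
  rw [lintegral_dirac' _ (Kernel.measurable_coe W hs)]

lemma leak_le_leakF {X Y Λ : Type*} [Fintype Λ] [DecidableEq Λ] [Nonempty Λ] [MeasurableSpace X]
    [MeasurableSpace Y] (Q : Measure Y) [IsProbabilityMeasure Q] (w : X → Y → ℝ≥0)
    (hw : Measurable (fun p : X × Y => w p.1 p.2)) (W : Kernel X Y) [IsMarkovKernel W]
    (hW : ∀ x, W x = Q.withDensity (fun y => w x y)) (c : Λ → X) :
    klDiv (W ∘ₘ ((Fintype.card Λ : ℝ≥0∞)⁻¹ • ∑ l, Measure.dirac (c l))) Q ≤ leakF Q w c := by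
  rw [comp_avg_dirac]
  exact leak Q w hw W hW c

/-- encoder of a codebook -/
def encC {n K₁ K₂ L : ℕ} (C : (Fin K₁ × Fin K₂) × Fin L → (Fin n → ℝ)) (m : Fin K₁ × Fin K₂) :
    Measure (Fin n → ℝ) := (Fintype.card (Fin L) : ℝ≥0∞)⁻¹ • ∑ l, Measure.dirac (C (m, l))

lemma encC_apply_of_mem {n K₁ K₂ L : ℕ} [NeZero L] (C : (Fin K₁ × Fin K₂) × Fin L → (Fin n → ℝ))
    (m : Fin K₁ × Fin K₂) (s : Set (Fin n → ℝ)) (hs : MeasurableSet s) (h : ∀ l, C (m, l) ∈ s) :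
    encC C m s = 1 := by
  rw [encC, Measure.smul_apply, Measure.finsetSum_apply, smul_eq_mul]
  simp only [Measure.dirac_apply' _ hs, Set.indicator_of_mem (h _)]
  simp only [Pi.one_apply, Finset.sum_const, Finset.card_univ, nsmul_eq_mul, mul_one]
  exact ENNReal.inv_mul_cancel (by simp [NeZero.ne]) (by simp)

instance {n K₁ K₂ L : ℕ} [NeZero L] (C : (Fin K₁ × Fin K₂) × Fin L → (Fin n → ℝ))
    (m : Fin K₁ × Fin K₂) : IsProbabilityMeasure (encC C m) :=
  ⟨encC_apply_of_mem C m _ MeasurableSet.univ fun _ => Set.mem_univ _⟩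

lemma enc1_encC {n K₁ K₂ L : ℕ} (C : (Fin K₁ × Fin K₂) × Fin L → (Fin n → ℝ))
    (m₁ : Fin K₁) : enc1 (encC C) m₁ = (Fintype.card (Fin K₂ × Fin L) : ℝ≥0∞)⁻¹ •
      ∑ q : Fin K₂ × Fin L, Measure.dirac (C ((m₁, q.1), q.2)) := by
  unfold enc1 encC
  rw [← Finset.smul_sum, smul_smul, Fintype.sum_prod_type, Fintype.card_prod, Nat.cast_mul,
    ENNReal.mul_inv (by simp) (by simp), Fintype.card_fin, Fintype.card_fin]

lemma code_exists {n K₁ K₂ L : ℕ} [NeZero K₁] [NeZero K₂] [NeZero L] {a b₁ b₂ P' P : ℝ}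
    (ha : 0 ≤ a) (hb₁ : 0 ≤ b₁) (hb₂ : 0 ≤ b₂) (hP' : 0 < P')
    (h : (2:ℝ≥0∞)⁻¹ ≤ gi n P' (pb n P)) (T : ℝ≥0) (hT : 0 < T) (e₀ d₁ d₂ : ℝ) (he₀ : 0 < e₀)
    (hd₁ : 0 < d₁) (hd₂ : 0 < d₂)
    (h0 : 2 * (gi n P' ⊗ₘ gk n (Real.sqrt a) 1) {p | wn a P' p.1 p.2 ≤ T} +
      (T : ℝ≥0∞)⁻¹ * ((K₁ * K₂ * L : ℕ) * 2) ≤ ENNReal.ofReal (e₀ / 3))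
    (h1 : 1 + 2 * ∫⁻ p, ENNReal.ofReal (Real.log (1 + wn b₂ P' p.1 p.2 / (L : ℕ)))
      ∂(gi n P' ⊗ₘ gk n (Real.sqrt b₂) 1) + 2 ≤ ENNReal.ofReal (d₁ * Real.log 2 / 3))
    (h2 : 1 + 2 * ∫⁻ p, ENNReal.ofReal (Real.log (1 + wn b₁ P' p.1 p.2 / (K₂ * L : ℕ)))
      ∂(gi n P' ⊗ₘ gk n (Real.sqrt b₁) 1) + 2 ≤ ENNReal.ofReal (d₂ * Real.log 2 / 3)) :
    ∃ enc : Fin K₁ × Fin K₂ → Measure (Fin n → ℝ),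
      (∀ m, IsProbabilityMeasure (enc m)) ∧
      (∀ m, enc m {xs | ∑ i, (xs i) ^ 2 ≤ (n : ℝ) * P} = 1) ∧
      ∃ dec : (Fin n → ℝ) → Fin K₁ × Fin K₂, Measurable dec ∧
        (jointLaw a enc {p | dec p.2 ≠ p.1}).toReal ≤ e₀ ∧
        miBits (jointLaw b₂ enc) ≤ d₁ ∧
        miBits ((jointLaw b₁ enc).map fun p => (p.1.1, p.2)) ≤ d₂ := by
  have hl2 : 0 < Real.log 2 := Real.log_pos (by norm_num)
  have hpr := tg_prob h
  set μ := tg n P' P with hμ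
  let ι := (Fin K₁ × Fin K₂) × Fin L
  have hcι : Fintype.card ι = K₁ * K₂ * L := by simp [ι]
  have hphi : ∀ s : ℝ, 0 ≤ s → ∀ N : ℕ, ∫⁻ x, phi (Qm n s P') (wn s P') N x ∂μ ≤
      2 * ∫⁻ p, ENNReal.ofReal (Real.log (1 + wn s P' p.1 p.2 / N)) ∂(gi n P' ⊗ₘ gk n (Real.sqrt s) 1) := by
    intro s hs N
    rw [lintegral_phi (Qm n s P') (wn s P') (measurable_wn s P') μ (gk n (Real.sqrt s) 1)
      (wn_dens hs hP'.le)]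
    have := (measurable_wn (n := n) s P').coe_nnreal_real
    exact tg_le_compProd h _ _ (by fun_prop)
  have hN : (Measure.pi fun _ : ι => μ) (⋃ i : ι, {C | C i ∉ pb n P}) = 0 := by
    refine measure_iUnion_null fun i => ?_
    have := (measurePreserving_eval (fun _ : ι => μ) i).measure_preimage
      (measurableSet_pb n P).compl.nullMeasurableSet
    rw [tg_null] at this
    exact this
  obtain ⟨C, hC, c0, c1, c2⟩ := choose3 (Measure.pi fun _ : ι => μ) _ hN
    (fun C => errF (Qm n a P') (wn a P') T C)
    (fun C => (Fintype.card (Fin K₁ × Fin K₂) : ℝ≥0∞)⁻¹ *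
      ∑ m : Fin K₁ × Fin K₂, leakF (Qm n b₂ P') (wn b₂ P') (fun l : Fin L => C (m, l)))
    (fun C => (Fintype.card (Fin K₁) : ℝ≥0∞)⁻¹ *
      ∑ m₁ : Fin K₁, leakF (Qm n b₁ P') (wn b₁ P') (fun q : Fin K₂ × Fin L => C ((m₁, q.1), q.2)))
    (measurable_errF _ _ (measurable_wn a P') T)
    ((Finset.measurable_fun_sum _ fun m _ =>
      measurable_leakF _ _ (measurable_wn b₂ P') (fun l => (m, l))).const_mul _)
    ((Finset.measurable_fun_sum _ fun m₁ _ =>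
      measurable_leakF _ _ (measurable_wn b₁ P') (fun q : Fin K₂ × Fin L => ((m₁, q.1), q.2))).const_mul _)
    e₀ (d₁ * Real.log 2) (d₂ * Real.log 2) he₀ (by positivity) (by positivity)
    (by
      refine le_trans (exp_errF _ _ (measurable_wn a P') μ _ (wn_dens ha hP'.le) 2
        (tg_lr ha hP' h) T) (le_trans ?_ h0)
      rw [hcι]
      gcongr
      have hms : MeasurableSet {p : (Fin n → ℝ) × (Fin n → ℝ) | wn a P' p.1 p.2 ≤ T} :=
        measurableSet_le (measurable_wn a P') measurable_const
      have := tg_le_compProd h (gk n (Real.sqrt a) 1) _ ((measurable_indicator_const_iff (1:ℝ≥0∞)).2 hms)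
      rwa [lintegral_indicator_const hms, lintegral_indicator_const hms, one_mul, one_mul] at this)
    (by
      refine avg_le _ _ (fun m => measurable_leakF _ _ (measurable_wn b₂ P') (fun l => (m, l))) _ fun m => ?_
      refine le_trans (exp_leakF _ _ (measurable_wn b₂ P') μ _ (wn_dens hb₂ hP'.le) 2
        (tg_lr hb₂ hP' h) (fun l : Fin L => (m, l)) (fun l l' hl => (Prod.mk.inj hl).2)) (le_trans ?_ h1)
      rw [Fintype.card_fin]
      gcongr
      exact hphi b₂ hb₂ L)
    (by
      refine avg_le _ _ (fun m₁ => measurable_leakF _ _ (measurable_wn b₁ P')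
        (fun q : Fin K₂ × Fin L => ((m₁, q.1), q.2))) _ fun m₁ => ?_
      refine le_trans (exp_leakF _ _ (measurable_wn b₁ P') μ _ (wn_dens hb₁ hP'.le) 2
        (tg_lr hb₁ hP' h) (fun q : Fin K₂ × Fin L => ((m₁, q.1), q.2)) ?_) (le_trans ?_ h2)
      · rintro ⟨q1, q2⟩ ⟨q1', q2'⟩ hq
        simp only [Prod.mk.injEq] at hq ⊢
        exact ⟨hq.1.2, hq.2⟩
      · rw [Fintype.card_prod, Fintype.card_fin, Fintype.card_fin]
        gcongr
        exact hphi b₁ hb₁ (K₂ * L))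
  have hC' : ∀ i, C i ∈ pb n P := by
    intro i
    by_contra hcon
    exact hC (Set.mem_iUnion.2 ⟨i, hcon⟩)
  obtain ⟨dec, hdm, hd⟩ := decoder (Qm n a P') (wn a P') (measurable_wn a P') (gk n (Real.sqrt a) 1)
    (wn_dens ha hP'.le) C T hT (fun i : ι => i.1)
  refine ⟨encC C, fun m => inferInstance, fun m => encC_apply_of_mem C m _ (measurableSet_pb n P)
    (fun l => hC' _), dec, hdm, ?_, ?_, ?_⟩
  · refine ENNReal.toReal_le_of_le_ofReal he₀.le (le_trans ?_ c0)
    have hms : MeasurableSet {p : (Fin K₁ × Fin K₂) × (Fin n → ℝ) | dec p.2 ≠ p.1} :=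
      (meas_dec dec hdm).compl
    rw [jointLaw_apply _ _ _ hms, errF, Fintype.sum_prod_type (γ := ℝ≥0∞) (α₁ := Fin K₁ × Fin K₂) (α₂ := Fin L), hcι, Nat.cast_mul, Nat.cast_mul,
      ENNReal.mul_inv (b := (L : ℝ≥0∞)) (Or.inr (by simp)) (Or.inr (by simp [NeZero.ne])), mul_assoc]
    refine mul_le_mul_right ?_ _
    rw [Finset.mul_sum]
    refine Finset.sum_le_sum fun m _ => ?_
    rw [encC, comp_avg_dirac, Measure.smul_apply, Measure.finsetSum_apply, smul_eq_mul, Fintype.card_fin]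
    refine mul_le_mul_right (Finset.sum_le_sum fun l _ => ?_) _
    exact hd (m, l)
  · rw [jointLaw_eq]
    refine miBits_le _ (Qm n b₂ P') ?_ d₁ hd₁.le (le_trans ?_ c1)
    · intro m
      rw [Kernel.comp_apply, kof_apply, encC, comp_avg_dirac]
      refine Measure.AbsolutelyContinuous.smul_left ?_ _
      refine Measure.AbsolutelyContinuous.mk fun s _ hs => ?_
      rw [Measure.finsetSum_apply]
      refine Finset.sum_eq_zero fun l _ => ?_
      rw [wn_dens hb₂ hP'.le]
      exact withDensity_absolutelyContinuous _ _ hs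
    · refine mul_le_mul_right (Finset.sum_le_sum fun m _ => ?_) _
      rw [Kernel.comp_apply, kof_apply, encC]
      exact leak_le_leakF _ _ (measurable_wn b₂ P') _ (wn_dens hb₂ hP'.le) (fun l => C (m, l))
  · rw [jointLaw_map_eq]
    refine miBits_le _ (Qm n b₁ P') ?_ d₂ hd₂.le (le_trans ?_ c2)
    · intro m
      rw [Kernel.comp_apply, kof_apply, enc1_encC, comp_avg_dirac]
      refine Measure.AbsolutelyContinuous.smul_left ?_ _
      refine Measure.AbsolutelyContinuous.mk fun s _ hs => ?_
      rw [Measure.finsetSum_apply]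
      refine Finset.sum_eq_zero fun l _ => ?_
      rw [wn_dens hb₁ hP'.le]
      exact withDensity_absolutelyContinuous _ _ hs
    · refine mul_le_mul_right (Finset.sum_le_sum fun m _ => ?_) _
      rw [Kernel.comp_apply, kof_apply, enc1_encC]
      exact leak_le_leakF _ _ (measurable_wn b₁ P') _ (wn_dens hb₁ hP'.le)
        (fun q : Fin K₂ × Fin L => C ((m, q.1), q.2))

end WT

namespace WT

open InformationTheory
open scoped NNReal

lemma ceil_exp (t : ℝ) (ht : 0 ≤ t) : 0 < ⌈Real.exp t⌉₊ ∧ t ≤ Real.log ⌈Real.exp t⌉₊ ∧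
    (⌈Real.exp t⌉₊ : ℝ) ≤ 2 * Real.exp t := by
  have h1 := Nat.le_ceil (Real.exp t)
  have h2 := Nat.ceil_lt_add_one (Real.exp_pos t).le
  have h3 := Real.one_le_exp ht
  refine ⟨Nat.ceil_pos.2 (Real.exp_pos t), ?_, by linarith⟩
  rw [Real.le_log_iff_exp_le (by linarith)]
  exact h1

lemma ev_div (A x : ℝ) (hx : 0 < x) : ∀ᶠ n : ℕ in Filter.atTop, A / n ≤ x :=
  (tendsto_const_div_atTop_nhds_zero_nat A).eventually_le_const hx

lemma leak_num {s P τ : ℝ} {n : ℕ} {L : ℕ} {V e : ℝ} (hV : 0 ≤ V) (hn : 0 < n) (hτ : 0 < τ)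
    (he : e = 24 * τ) (hL : n * (1 / 2 * Real.log (1 + s * P) - τ) ≤ Real.log L)
    (hb : (3 + 2 * Real.log 2 + 2 * V / τ) / n ≤ 4 * τ)
    (h : ∫⁻ p, ENNReal.ofReal (Real.log (1 + wn s P p.1 p.2 / L)) ∂(gi n P ⊗ₘ gk n (Real.sqrt s) 1) ≤
      ENNReal.ofReal (Real.log 2 + n * τ + V / τ +
        max (n * (1 / 2 * Real.log (1 + s * P)) - Real.log L) 0)) :
    1 + 2 * ∫⁻ p, ENNReal.ofReal (Real.log (1 + wn s P p.1 p.2 / L)) ∂(gi n P ⊗ₘ gk n (Real.sqrt s) 1) + 2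
      ≤ ENNReal.ofReal (n * e / 3) := by
  have hn' : (0:ℝ) < n := by exact_mod_cast hn
  have hl2 : 0 < Real.log 2 := Real.log_pos (by norm_num)
  have hm : max (n * (1 / 2 * Real.log (1 + s * P)) - Real.log L) 0 ≤ n * τ :=
    max_le (by linarith) (by positivity)
  have hm0 : 0 ≤ max (n * (1 / 2 * Real.log (1 + s * P)) - Real.log L) 0 := le_max_right _ _
  rw [div_le_iff₀ hn'] at hb
  set m := max (n * (1 / 2 * Real.log (1 + s * P)) - Real.log L) 0
  calc _ ≤ ENNReal.ofReal 1 + ENNReal.ofReal 2 * ENNReal.ofReal (Real.log 2 + n * τ + V / τ + m)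
        + ENNReal.ofReal 2 := by
        rw [ENNReal.ofReal_one, ENNReal.ofReal_ofNat]
        gcongr
    _ = ENNReal.ofReal (1 + 2 * (Real.log 2 + n * τ + V / τ + m) + 2) := by
        rw [← ENNReal.ofReal_mul (by norm_num), ← ENNReal.ofReal_add (by norm_num) (by positivity),
          ← ENNReal.ofReal_add (by positivity) (by norm_num)]
    _ ≤ _ := by
        apply ENNReal.ofReal_le_ofReal
        rw [he]
        have : 2 * V / τ = 2 * (V / τ) := by ring
        linarith

lemma ach_core {a b₁ b₂ P' P r₁ r₂ δ τ ε : ℝ} (ha : 0 ≤ a) (hb₁ : 0 ≤ b₁) (hb₂ : 0 ≤ b₂)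
    (hP' : 0 < P') (hP : P' < P) (hr₁ : 0 ≤ r₁) (hr₂ : 0 ≤ r₂) (hδ : 0 < δ) (hε : 0 < ε)
    (hτ : ε * Real.log 2 = 24 * τ)
    (hsum : r₁ + r₂ + δ ≤ 1 / 2 * Real.log (1 + a * P'))
    (hc₂ : 1 / 2 * Real.log (1 + b₂ * P') - τ ≤ 1 / 2 * Real.log (1 + a * P') - δ - r₁ - r₂)
    (hc₁ : 1 / 2 * Real.log (1 + b₁ * P') - τ ≤ 1 / 2 * Real.log (1 + a * P') - δ - r₁) :
    ∃ n : ℕ, 0 < n ∧ ∃ K₁ K₂ : ℕ, 0 < K₁ ∧ 0 < K₂ ∧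
    (n : ℝ) * r₁ ≤ Real.log K₁ ∧ (n : ℝ) * r₂ ≤ Real.log K₂ ∧ (r₁ = 0 → K₁ = 1) ∧
    ∃ enc : Fin K₁ × Fin K₂ → Measure (Fin n → ℝ),
      (∀ m, IsProbabilityMeasure (enc m)) ∧
      (∀ m, enc m {xs | ∑ i, (xs i) ^ 2 ≤ (n : ℝ) * P} = 1) ∧
      ∃ dec : (Fin n → ℝ) → Fin K₁ × Fin K₂, Measurable dec ∧
        (jointLaw a enc {p | dec p.2 ≠ p.1}).toReal ≤ ε ∧
        miBits (jointLaw b₂ enc) ≤ (n : ℝ) * ε ∧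
        miBits ((jointLaw b₁ enc).map fun p => (p.1.1, p.2)) ≤ (n : ℝ) * ε := by
  have hl2 : 0 < Real.log 2 := Real.log_pos (by norm_num)
  have hτ0 : 0 < τ := by have := mul_pos hε hl2; linarith
  obtain ⟨V, hV, hball⟩ := ball_bound hP'.le hP
  obtain ⟨V₀, hV₀, herr⟩ := err_bound ha hP'.le
  obtain ⟨V₁, hV₁, hph₁⟩ := phi_bound hb₁ hP'.le
  obtain ⟨V₂, hV₂, hph₂⟩ := phi_bound hb₂ hP'.le
  set Ia := 1 / 2 * Real.log (1 + a * P') with hIa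
  obtain ⟨n, hn, hn1, hn2, hn3, hn4⟩ := ((Filter.eventually_gt_atTop 0).and
    ((ev_div V (1 / 2) (by norm_num)).and
    ((ev_div (8 * V₀ / δ ^ 2 + 32 / δ) (ε / 3) (by positivity)).and
    ((ev_div (3 + 2 * Real.log 2 + 2 * V₁ / τ) (4 * τ) (by positivity)).and
    (ev_div (3 + 2 * Real.log 2 + 2 * V₂ / τ) (4 * τ) (by positivity)))))).exists
  have hn' : (0:ℝ) < n := by exact_mod_cast hn
  set ℓ := Ia - δ - r₁ - r₂ with hℓ
  have hℓ0 : 0 ≤ ℓ := by linarith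
  obtain ⟨k1a, k1b, k1c⟩ := ceil_exp (n * r₁) (by positivity)
  obtain ⟨k2a, k2b, k2c⟩ := ceil_exp (n * r₂) (by positivity)
  obtain ⟨la, lb, lc⟩ := ceil_exp (n * ℓ) (by positivity)
  have hK1 : r₁ = 0 → ⌈Real.exp (n * r₁)⌉₊ = 1 := by
    rintro rfl; simp
  set K₁ := ⌈Real.exp (n * r₁)⌉₊
  set K₂ := ⌈Real.exp (n * r₂)⌉₊
  set L := ⌈Real.exp (n * ℓ)⌉₊
  have i1 : NeZero K₁ := ⟨k1a.ne'⟩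
  have i2 : NeZero K₂ := ⟨k2a.ne'⟩
  have i3 : NeZero L := ⟨la.ne'⟩
  have hhalf : (2:ℝ≥0∞)⁻¹ ≤ gi n P' (pb n P) := by
    have h1 : gi n P' (pb n P)ᶜ ≤ (2:ℝ≥0∞)⁻¹ := by
      refine (hball n hn).trans ?_
      refine (ENNReal.ofReal_le_ofReal hn1).trans (le_of_eq ?_)
      rw [one_div, ENNReal.ofReal_inv_of_pos (by norm_num), ENNReal.ofReal_ofNat]
    have h2 := prob_add_prob_compl (μ := gi n P') (measurableSet_pb n P)
    by_contra hcon
    rw [not_le] at hcon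
    have h3 : gi n P' (pb n P) + gi n P' (pb n P)ᶜ < 1 := by
      calc _ < (2:ℝ≥0∞)⁻¹ + 2⁻¹ := ENNReal.add_lt_add_of_lt_of_le (measure_ne_top _ _) hcon h1
        _ = 1 := ENNReal.inv_two_add_inv_two
    exact absurd h2 h3.ne
  refine ⟨n, hn, K₁, K₂, k1a, k2a, k1b, k2b, hK1, ?_⟩
  have hT0 : 0 < (Real.exp (n * (Ia - δ / 2))).toNNReal := Real.toNNReal_pos.2 (Real.exp_pos _)
  refine code_exists (L := L) ha hb₁ hb₂ hP' hhalf (Real.exp (n * (Ia - δ / 2))).toNNReal hT0 ε (n * ε) (n * ε)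
    hε (by positivity) (by positivity) ?_ ?_ ?_
  · have h1 := herr n hn (δ / 2) (by positivity)
    have hprod : ((K₁ * K₂ * L : ℕ) : ℝ) ≤ 8 * Real.exp (n * (Ia - δ)) := by
      push_cast
      calc (K₁ : ℝ) * K₂ * L ≤ (2 * Real.exp (n * r₁)) * (2 * Real.exp (n * r₂)) * (2 * Real.exp (n * ℓ)) := by
            gcongr
        _ = 8 * (Real.exp (n * r₁) * Real.exp (n * r₂) * Real.exp (n * ℓ)) := by ring
        _ = _ := by
            rw [← Real.exp_add, ← Real.exp_add, hℓ]; ring_nf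
    calc _ ≤ ENNReal.ofReal 2 * ENNReal.ofReal (V₀ / (n * (δ / 2) ^ 2)) +
          ENNReal.ofReal ((Real.exp (n * (Ia - δ / 2)))⁻¹) *
            (ENNReal.ofReal (8 * Real.exp (n * (Ia - δ))) * ENNReal.ofReal 2) := by
          rw [ENNReal.ofReal_ofNat, ENNReal.ofReal_inv_of_pos (Real.exp_pos _)]
          gcongr
          · exact le_rfl
          · rw [← ENNReal.ofReal_natCast]
            exact ENNReal.ofReal_le_ofReal hprod
      _ = ENNReal.ofReal (2 * (V₀ / (n * (δ / 2) ^ 2)) + (Real.exp (n * (Ia - δ / 2)))⁻¹ *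
            (8 * Real.exp (n * (Ia - δ)) * 2)) := by
          rw [← ENNReal.ofReal_mul (by norm_num), ← ENNReal.ofReal_mul (by positivity),
            ← ENNReal.ofReal_mul (by positivity), ← ENNReal.ofReal_add (by positivity) (by positivity)]
      _ ≤ _ := by
          apply ENNReal.ofReal_le_ofReal
          refine le_trans ?_ hn2
          have h3 : (Real.exp (n * (Ia - δ / 2)))⁻¹ * (8 * Real.exp (n * (Ia - δ)) * 2)
              = 16 * (Real.exp (n * (δ / 2)))⁻¹ := by
            rw [← Real.exp_neg, ← Real.exp_neg]
            have : Real.exp (-(n * (δ / 2))) = Real.exp (-(n * (Ia - δ / 2))) * Real.exp (n * (Ia - δ)) := by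
              rw [← Real.exp_add]; ring_nf
            rw [this]; ring
          rw [h3]
          have h4 : (Real.exp (n * (δ / 2)))⁻¹ ≤ (n * (δ / 2))⁻¹ := by
            apply inv_anti₀ (by positivity)
            have := Real.add_one_le_exp (n * (δ / 2))
            linarith
          calc _ ≤ 2 * (V₀ / (n * (δ / 2) ^ 2)) + 16 * (n * (δ / 2))⁻¹ := by gcongr
            _ = _ := by field_simp; ring
  · rw [show (n * ε * Real.log 2 / 3 : ℝ) = n * (24 * τ) / 3 by rw [← hτ]; ring]
    refine leak_num hV₂ hn hτ0 rfl ?_ hn4 (hph₂ n hn τ hτ0 L (by exact_mod_cast la))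
    refine le_trans ?_ lb
    gcongr
  · rw [show (n * ε * Real.log 2 / 3 : ℝ) = n * (24 * τ) / 3 by rw [← hτ]; ring]
    refine leak_num hV₁ hn hτ0 rfl ?_ hn3 (hph₁ n hn τ hτ0 (K₂ * L : ℕ) (by positivity))
    rw [Nat.cast_mul, Real.log_mul (by positivity) (by positivity)]
    refine le_trans ?_ (add_le_add k2b lb)
    rw [← mul_add]
    gcongr
    linarith

end WT

namespace WT

open InformationTheory
open scoped NNReal

lemma Cs_log (P a b : ℝ) : Cs P a b * Real.log 2 =
    max 0 (1 / 2 * Real.log (1 + a * P) - 1 / 2 * Real.log (1 + b * P)) := by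
  have hl2 : 0 < Real.log 2 := Real.log_pos (by norm_num)
  rw [Cs, max_mul_of_nonneg _ _ hl2.le, zero_mul, Real.logb, Real.logb]
  congr 1
  field_simp

lemma ach_trivial (a b₁ b₂ P : ℝ) (hP : 0 ≤ P) : GaussAchievable a b₁ b₂ P 0 0 := by
  intro ε hε
  have hpr : ∀ m : Fin 1 × Fin 1, IsProbabilityMeasure
      ((fun _ => Measure.dirac 0 : Fin 1 × Fin 1 → Measure (Fin 1 → ℝ)) m) := fun m => by
    dsimp only; infer_instance
  refine ⟨1, one_pos, 1, 1, one_pos, one_pos, by simp [hε.le], by simp [hε.le],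
    fun _ => Measure.dirac 0, hpr, fun m => ?_, fun _ => (0, 0), measurable_const, ?_, ?_, ?_⟩
  · rw [Measure.dirac_apply' _ (measurableSet_pball 1 P)]
    rw [Set.indicator_of_mem]
    · rfl
    · simp [hP]
  · have : {p : (Fin 1 × Fin 1) × (Fin 1 → ℝ) | ((0, 0) : Fin 1 × Fin 1) ≠ p.1} = ∅ := by
      ext p
      simp only [Set.mem_ofPred_eq, Set.mem_empty_iff_false, iff_false, not_not]
      exact Subsingleton.elim _ _
    rw [this]
    simp [hε.le]
  · rw [jointLaw_eq]
    exact (miBits_subsingleton _).trans (by positivity)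
  · rw [jointLaw_map_eq]
    exact (miBits_subsingleton _).trans (by positivity)

lemma exists_power (a P κ : ℝ) (ha : 0 ≤ a) (hP : 0 < P) (hκ : 0 < κ) :
    ∃ P', 0 < P' ∧ P' < P ∧ 1 / 2 * Real.log (1 + a * P) - κ ≤ 1 / 2 * Real.log (1 + a * P') := by
  have hc : ContinuousAt (fun p : ℝ => 1 / 2 * Real.log (1 + a * p)) P := by
    have : 1 + a * P ≠ 0 := by positivity
    exact ContinuousAt.mul continuousAt_const (ContinuousAt.log (by fun_prop) this)
  have h1 : ∀ᶠ p in nhdsWithin P (Set.Iio P),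
      1 / 2 * Real.log (1 + a * P) - κ ≤ 1 / 2 * Real.log (1 + a * p) :=
    (hc.tendsto.mono_left nhdsWithin_le_nhds).eventually_const_le (by linarith)
  obtain ⟨p, hp1, hp2⟩ := (h1.and (Ioo_mem_nhdsLT hP)).exists
  exact ⟨p, hp2.1, hp2.2, hp1⟩

lemma log_mono {b P' P : ℝ} (hb : 0 ≤ b) (hP' : 0 < P') (h : P' < P) :
    1 / 2 * Real.log (1 + b * P') ≤ 1 / 2 * Real.log (1 + b * P) := by
  have : Real.log (1 + b * P') ≤ Real.log (1 + b * P) := by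
    apply Real.log_le_log (by positivity)
    gcongr
  linarith

theorem achievability (a b₁ b₂ P : ℝ) (ha : 0 ≤ a) (hb₁₂ : b₂ ≤ b₁) (hb₂ : 0 ≤ b₂) (hP : 0 ≤ P)
    (R₁ R₂ : ℝ) (hR₁ : 0 ≤ R₁) (hR₂ : 0 ≤ R₂) (h₁ : R₁ ≤ Cs P a b₁) (h₂ : R₁ + R₂ ≤ Cs P a b₂) :
    GaussAchievable a b₁ b₂ P R₁ R₂ := by
  have hl2 : 0 < Real.log 2 := Real.log_pos (by norm_num)
  have hb₁ : 0 ≤ b₁ := hb₂.trans hb₁₂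
  have h₁' := mul_le_mul_of_nonneg_right h₁ hl2.le
  have h₂' := mul_le_mul_of_nonneg_right h₂ hl2.le
  rw [Cs_log] at h₁' h₂'
  by_cases hz : 1 / 2 * Real.log (1 + a * P) - 1 / 2 * Real.log (1 + b₂ * P) ≤ 0
  · rw [max_eq_left hz] at h₂'
    have h3 : R₁ + R₂ ≤ 0 := nonpos_of_mul_nonpos_left h₂' hl2
    obtain rfl : R₁ = 0 := by linarith
    obtain rfl : R₂ = 0 := by linarith
    exact ach_trivial a b₁ b₂ P hP
  rw [not_le] at hz
  rw [max_eq_right hz.le] at h₂'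
  have hP0 : 0 < P := by
    rcases hP.eq_or_lt with h | h
    · rw [← h] at hz; simp at hz
    · exact h
  have hIb : 0 ≤ 1 / 2 * Real.log (1 + b₂ * P) := by
    have : 0 ≤ Real.log (1 + b₂ * P) := Real.log_nonneg (by nlinarith [mul_nonneg hb₂ hP])
    linarith
  intro ε hε
  set τ := ε * Real.log 2 / 24 with hτ
  have hε2 : 0 < ε * Real.log 2 := by positivity
  have hτ0 : 0 < τ := by positivity
  set Ia := 1 / 2 * Real.log (1 + a * P) with hIa
  have hIa0 : 0 < Ia := by linarith
  set δ := min τ Ia / 2 with hδ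
  have hδ0 : 0 < δ := by have := lt_min hτ0 hIa0; positivity
  have hδ1 : δ + δ ≤ τ := by have := min_le_left τ Ia; linarith
  have hδ2 : δ + δ ≤ Ia := by have := min_le_right τ Ia; linarith
  obtain ⟨P', hP'0, hP'P, hPa⟩ := exists_power a P δ ha hP0 hδ0
  set r₁ := max (R₁ - ε) 0 * Real.log 2 with hr₁
  set r₂ := max (R₂ - ε) 0 * Real.log 2 with hr₂
  have hr₁0 : 0 ≤ r₁ := mul_nonneg (le_max_right _ _) hl2.le
  have hr₂0 : 0 ≤ r₂ := mul_nonneg (le_max_right _ _) hl2.le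
  have hr₁R : r₁ ≤ R₁ * Real.log 2 :=
    mul_le_mul_of_nonneg_right (max_le (by linarith) hR₁) hl2.le
  have hr₂R : r₂ ≤ R₂ * Real.log 2 :=
    mul_le_mul_of_nonneg_right (max_le (by linarith) hR₂) hl2.le
  have hmon₂ := log_mono hb₂ hP'0 hP'P
  have hmon₁ := log_mono hb₁ hP'0 hP'P
  have hτε : τ ≤ ε * Real.log 2 := by rw [hτ]; linarith
  have hsum : r₁ + r₂ + δ ≤ 1 / 2 * Real.log (1 + a * P') := by
    have key : r₁ + r₂ ≤ max ((R₁ + R₂ - ε) * Real.log 2) 0 := by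
      have : max (R₁ - ε) 0 + max (R₂ - ε) 0 ≤ max (R₁ + R₂ - ε) 0 := by
        rcases le_total (R₁ - ε) 0 with h | h <;> rcases le_total (R₂ - ε) 0 with h' | h' <;>
          simp only [max_eq_left, max_eq_right, h, h']
        · simp
        · exact le_max_of_le_left (by linarith)
        · exact le_max_of_le_left (by linarith)
        · exact le_max_of_le_left (by linarith)
      calc r₁ + r₂ = (max (R₁ - ε) 0 + max (R₂ - ε) 0) * Real.log 2 := by rw [hr₁, hr₂]; ring
        _ ≤ max (R₁ + R₂ - ε) 0 * Real.log 2 := by gcongr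
        _ = _ := by rw [max_mul_of_nonneg _ _ hl2.le, zero_mul]
    have h5 : max ((R₁ + R₂ - ε) * Real.log 2) 0 ≤ Ia - δ - δ :=
      max_le (by linarith) (by linarith)
    linarith
  have hc₂ : 1 / 2 * Real.log (1 + b₂ * P') - τ ≤ 1 / 2 * Real.log (1 + a * P') - δ - r₁ - r₂ := by
    linarith
  have rate : ∀ (n K : ℕ) (R : ℝ), (n : ℝ) * (max (R - ε) 0 * Real.log 2) ≤ Real.log K →
      (n : ℝ) * (R - ε) ≤ Real.logb 2 K := by
    intro n K R h
    rw [Real.logb, le_div_iff₀ hl2]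
    refine le_trans ?_ h
    rw [mul_assoc]
    gcongr
    exact le_max_left _ _
  by_cases hz₁ : 1 / 2 * Real.log (1 + a * P) - 1 / 2 * Real.log (1 + b₁ * P) ≤ 0
  · rw [max_eq_left hz₁] at h₁'
    have hR0 : R₁ ≤ 0 := nonpos_of_mul_nonpos_left h₁' hl2
    have hr0 : r₁ = 0 := by
      rw [hr₁, max_eq_right (by linarith), zero_mul]
    obtain ⟨n, hn, K₁, K₂, hK₁, hK₂, k1, k2, k3, enc, e1, e2, dec, d1, d2, d3, d4⟩ :=
      ach_core (b₁ := b₂) (τ := τ) ha hb₂ hb₂ hP'0 hP'P hr₁0 hr₂0 hδ0 hε (by rw [hτ]; ring) hsum hc₂ (by linarith)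
    refine ⟨n, hn, K₁, K₂, hK₁, hK₂, rate _ _ _ k1, rate _ _ _ k2, enc, e1, e2, dec, d1, d2, d3, ?_⟩
    obtain rfl := k3 hr0
    have i2 : NeZero K₂ := ⟨hK₂.ne'⟩
    rw [jointLaw_map_eq]
    exact (miBits_subsingleton _).trans (by positivity)
  · rw [not_le] at hz₁
    rw [max_eq_right hz₁.le] at h₁'
    obtain ⟨n, hn, K₁, K₂, hK₁, hK₂, k1, k2, k3, enc, e1, e2, dec, d1, d2, d3, d4⟩ :=
      ach_core (b₁ := b₁) (τ := τ) ha hb₁ hb₂ hP'0 hP'P hr₁0 hr₂0 hδ0 hε (by rw [hτ]; ring) hsum hc₂ (by linarith)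
    exact ⟨n, hn, K₁, K₂, hK₁, hK₂, rate _ _ _ k1, rate _ _ _ k2, enc, e1, e2, dec, d1, d2, d3, d4⟩

end WT

/-- the secrecy capacity region of the scalar Gaussian two-level security
wiretap channel is exactly the set of nonnegative pairs with `R₁ ≤ Cs(P,a,b₁)` and
`R₁ + R₂ ≤ Cs(P,a,b₂)`. -/
theorem stmt6_gaussian_capacity_region (a b₁ b₂ P : ℝ)
    (ha : 0 ≤ a) (hb₁₂ : b₁ ≥ b₂) (hb₂ : b₂ ≥ 0) (hP : 0 ≤ P)
    (R₁ R₂ : ℝ) (hR₁ : 0 ≤ R₁) (hR₂ : 0 ≤ R₂) :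
    GaussAchievable a b₁ b₂ P R₁ R₂ ↔ R₁ ≤ Cs P a b₁ ∧ R₁ + R₂ ≤ Cs P a b₂ := by
  constructor
  · exact fun h => WT.converse a b₁ b₂ P ha hb₁₂ hb₂ hP R₁ R₂ h
  · exact fun h => WT.achievability a b₁ b₂ P ha hb₁₂ hb₂ hP R₁ R₂ hR₁ hR₂ h.1 h.2
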